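/- For every SKS derivation Φ, there exists a super-streamlined SKS derivation Ψ with the same premiss and the same conclusion as Φ. (In particular, every SKS derivation can be streamlined.) -/

import Mathlib

set_option linter.unusedVariables false

namespace AF

/-! ### Formulae of system SKS.

Atoms are pairs `(n, b)`; the involution `ā` flips the Boolean, so it is
fixed-point free. -/

inductive Formula : Type
  | tt : Formula
  | ff : Formula
  | atom : ℕ → Bool → Formula
  | or : Formula → Formula → Formula
  | and : Formula → Formula → Formula
  deriving DecidableEq

namespace Formula

/-- Subformula at a position (`false` = left child, `true` = right child). -/
def sub : Formula → List Bool → Option Formula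
  | φ, [] => some φ
  | .or α _, false :: p => sub α p
  | .or _ β, true :: p => sub β p
  | .and α _, false :: p => sub α p
  | .and _ β, true :: p => sub β p
  | _, _ :: _ => none

/-- Replace the subformula at a position. -/
def repl : Formula → List Bool → Formula → Formula
  | _, [], ψ => ψ
  | .or α β, false :: p, ψ => .or (repl α p ψ) β
  | .or α β, true :: p, ψ => .or α (repl β p ψ)
  | .and α β, false :: p, ψ => .and (repl α p ψ) β
  | .and α β, true :: p, ψ => .and α (repl β p ψ)
  | φ, _ :: _, _ => φ

/-- `p` is an atom occurrence of `φ`. -/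
def IsOcc (φ : Formula) (p : List Bool) : Prop :=
  ∃ n b, φ.sub p = some (.atom n b)

end Formula

/-! ### Inference rules.

The rule `=` of SKS replaces a formula by an equivalent one under
commutativity, associativity and the unit equations; each single instance of
`=` applies one equation (in either direction), so we list the equations as
individual rule names, all marked as being instances of `=` via `isEq`. -/

inductive RuleName : Type
  | aiDown | aiUp | awDown | awUp | acDown | acUp
  | s | m
  | eqOrComm | eqAndComm
  | eqOrAssocL | eqOrAssocR | eqAndAssocL | eqAndAssocR
  | eqOrUnitDel | eqOrUnitAdd | eqAndUnitDel | eqAndUnitAdd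
  | eqTTDel | eqTTAdd | eqFFDel | eqFFAdd
  deriving DecidableEq

namespace RuleName

/-- The atomic structural rules. -/
def isStructural : RuleName → Bool
  | .aiDown | .aiUp | .awDown | .awUp | .acDown | .acUp => true
  | _ => false

/-- The rule names that are instances of the rule `=`. -/
def isEq : RuleName → Bool
  | .aiDown | .aiUp | .awDown | .awUp | .acDown | .acUp | .s | .m => false
  | _ => true

end RuleName

/-- Rule instances (redex ⟹ contractum). -/
inductive RuleInstance : RuleName → Formula → Formula → Prop
  | aiDown (n : ℕ) (b : Bool) :
      RuleInstance .aiDown .tt (.or (.atom n b) (.atom n (!b)))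
  | aiUp (n : ℕ) (b : Bool) :
      RuleInstance .aiUp (.and (.atom n b) (.atom n (!b))) .ff
  | awDown (n : ℕ) (b : Bool) : RuleInstance .awDown .ff (.atom n b)
  | awUp (n : ℕ) (b : Bool) : RuleInstance .awUp (.atom n b) .tt
  | acDown (n : ℕ) (b : Bool) :
      RuleInstance .acDown (.or (.atom n b) (.atom n b)) (.atom n b)
  | acUp (n : ℕ) (b : Bool) :
      RuleInstance .acUp (.atom n b) (.and (.atom n b) (.atom n b))
  | s (α β γ : Formula) :
      RuleInstance .s (.and α (.or β γ)) (.or (.and α β) γ)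
  | m (α β γ δ : Formula) :
      RuleInstance .m (.or (.and α β) (.and γ δ)) (.and (.or α γ) (.or β δ))
  | eqOrComm (α β : Formula) : RuleInstance .eqOrComm (.or α β) (.or β α)
  | eqAndComm (α β : Formula) : RuleInstance .eqAndComm (.and α β) (.and β α)
  | eqOrAssocL (α β γ : Formula) :
      RuleInstance .eqOrAssocL (.or (.or α β) γ) (.or α (.or β γ))
  | eqOrAssocR (α β γ : Formula) :
      RuleInstance .eqOrAssocR (.or α (.or β γ)) (.or (.or α β) γ)
  | eqAndAssocL (α β γ : Formula) :
      RuleInstance .eqAndAssocL (.and (.and α β) γ) (.and α (.and β γ))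
  | eqAndAssocR (α β γ : Formula) :
      RuleInstance .eqAndAssocR (.and α (.and β γ)) (.and (.and α β) γ)
  | eqOrUnitDel (α : Formula) : RuleInstance .eqOrUnitDel (.or α .ff) α
  | eqOrUnitAdd (α : Formula) : RuleInstance .eqOrUnitAdd α (.or α .ff)
  | eqAndUnitDel (α : Formula) : RuleInstance .eqAndUnitDel (.and α .tt) α
  | eqAndUnitAdd (α : Formula) : RuleInstance .eqAndUnitAdd α (.and α .tt)
  | eqTTDel : RuleInstance .eqTTDel (.or .tt .tt) .tt
  | eqTTAdd : RuleInstance .eqTTAdd .tt (.or .tt .tt)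
  | eqFFDel : RuleInstance .eqFFDel (.and .ff .ff) .ff
  | eqFFAdd : RuleInstance .eqFFAdd .ff (.and .ff .ff)

/-- One (deep) inference step applying rule `r` at position `q`. -/
def StepAt (r : RuleName) (q : List Bool) (φ ψ : Formula) : Prop :=
  ∃ γ δ, φ.sub q = some γ ∧ RuleInstance r γ δ ∧ ψ = φ.repl q δ

/-- One inference step using a rule from the set `S`. -/
def Step (S : Set RuleName) (φ ψ : Formula) : Prop :=
  ∃ r ∈ S, ∃ q, StepAt r q φ ψ

/-- There is a derivation from `φ` to `ψ` using only rules from `S`. -/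
def Derives (S : Set RuleName) : Formula → Formula → Prop :=
  Relation.ReflTransGen (Step S)

/-! ### Derivations as explicit data (for the theory of atomic flows). -/

/-- A derivation: a premiss and a chain of steps, each recorded by its rule
name, the position of the redex, and the resulting formula. -/
structure Deriv : Type where
  prem : Formula
  steps : List (RuleName × List Bool × Formula)

namespace Deriv

/-- The `i`-th step datum. -/
def stepAt (Φ : Deriv) (i : ℕ) : RuleName × List Bool × Formula :=
  Φ.steps.getD i (RuleName.s, ([] : List Bool), Formula.tt)

/-- The `i`-th formula of the derivation (`0` is the premiss). -/
def fml (Φ : Deriv) (i : ℕ) : Formula :=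
  (Φ.prem :: Φ.steps.map (fun t => t.2.2)).getD i Φ.prem

/-- Number of formulae in the derivation. -/
def nf (Φ : Deriv) : ℕ := Φ.steps.length + 1

/-- The conclusion of the derivation. -/
def concl (Φ : Deriv) : Formula := Φ.fml Φ.steps.length

/-- The derivation is well formed: every recorded step is a correct
inference step of SKS. -/
def WF (Φ : Deriv) : Prop :=
  ∀ i, i < Φ.steps.length →
    StepAt (Φ.stepAt i).1 (Φ.stepAt i).2.1 (Φ.fml i) (Φ.fml (i + 1))

end Deriv

/-! ### Atomic flows. -/

inductive FlowLabel : Type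
  | aiDown | aiUp | awDown | awUp | acDown | acUp
  deriving DecidableEq

/-- Required (number of lower edges, number of upper edges) of a vertex. -/
def labDeg : FlowLabel → ℕ × ℕ
  | .aiDown => (2, 0)
  | .aiUp => (0, 2)
  | .awDown => (1, 0)
  | .awUp => (0, 1)
  | .acDown => (1, 2)
  | .acUp => (2, 1)

/-- The data of an atomic flow: vertices, edges, labels, and the two
endpoint maps.  `up e = none` means the upper endpoint is `⊤`, and
`lo e = none` means the lower endpoint is `⊥`. -/
structure PreFlow : Type where
  V : Finset ℕ
  E : Finset ℕ
  η : ℕ → FlowLabel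
  up : ℕ → Option ℕ
  lo : ℕ → Option ℕ

namespace PreFlow

/-- Lower edges of a vertex. -/
def Ledges (F : PreFlow) (v : ℕ) : Finset ℕ :=
  F.E.filter (fun e => F.up e = some v)

/-- Upper edges of a vertex. -/
def Uedges (F : PreFlow) (v : ℕ) : Finset ℕ :=
  F.E.filter (fun e => F.lo e = some v)

/-- All edges of a vertex. -/
def edges (F : PreFlow) (v : ℕ) : Finset ℕ := F.Ledges v ∪ F.Uedges v

def degOK (F : PreFlow) : Prop :=
  ∀ v ∈ F.V, (F.Ledges v).card = (labDeg (F.η v)).1 ∧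
    (F.Uedges v).card = (labDeg (F.η v)).2

def endpointsOK (F : PreFlow) : Prop :=
  ∀ e ∈ F.E, (∀ v, F.up e = some v → v ∈ F.V) ∧
    (∀ v, F.lo e = some v → v ∈ F.V)

/-- No cyclic sequence of edges `ε₁, …, ε_h` with
`up (ε_i) = lo (ε_(i+1 mod h))`. -/
def Acyclic (F : PreFlow) : Prop :=
  ¬ ∃ (h : ℕ) (ε : Fin (h + 1) → ℕ), (∀ i, ε i ∈ F.E) ∧
      ∀ i : Fin (h + 1), (F.up (ε i)).isSome ∧ F.up (ε i) = F.lo (ε (i + 1))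

/-- `π` is a polarity assignment (`false` = `−`, `true` = `+`). -/
def PolarityOK (F : PreFlow) (π : ℕ → Bool) : Prop :=
  ∀ v ∈ F.V,
    ((F.η v = .acDown ∨ F.η v = .acUp) →
      ∀ e₁ ∈ F.edges v, ∀ e₂ ∈ F.edges v, π e₁ = π e₂) ∧
    ((F.η v = .aiDown ∨ F.η v = .aiUp) →
      ∃ e₁ ∈ F.edges v, ∃ e₂ ∈ F.edges v, π e₁ ≠ π e₂)

/-- `F` is an atomic flow. -/
def IsFlow (F : PreFlow) : Prop :=
  F.degOK ∧ F.endpointsOK ∧ F.Acyclic ∧ ∃ π, F.PolarityOK π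

end PreFlow

/-! ### Paths, ai-paths, cycles. -/

/-- An endpoint of a path: a vertex, or `⊤`, or `⊥`. -/
inductive VPt : Type
  | ver : ℕ → VPt
  | top : VPt
  | bot : VPt
  deriving DecidableEq

/-- The upper endpoint of edge `e` is `ν`. -/
def srcOK (F : PreFlow) (ν : VPt) (e : ℕ) : Prop :=
  match ν with
  | .ver v => F.up e = some v
  | .top => F.up e = none
  | .bot => False

/-- The lower endpoint of edge `e` is `ν`. -/
def tgtOK (F : PreFlow) (ν : VPt) (e : ℕ) : Prop :=
  match ν with
  | .ver v => F.lo e = some v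
  | .bot => F.lo e = none
  | .top => False

/-- A downward path from `ν` to `ν'` (a nonempty sequence of edges, each
hanging from the lower endpoint of the previous one). -/
def IsDownPath (F : PreFlow) (ν ν' : VPt) (l : List ℕ) : Prop :=
  l ≠ [] ∧ (∀ e ∈ l, e ∈ F.E) ∧
  (∀ i, i + 1 < l.length →
    ∃ v ∈ F.V, F.lo (l.getD i 0) = some v ∧ F.up (l.getD (i + 1) 0) = some v) ∧
  srcOK F ν (l.getD 0 0) ∧ tgtOK F ν' (l.getD (l.length - 1) 0)

/-- A path from `ν` to `ν'`: a downward path, or the reverse of a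
downward path from `ν'` to `ν`. -/
def IsPath (F : PreFlow) (ν ν' : VPt) (l : List ℕ) : Prop :=
  IsDownPath F ν ν' l ∨ IsDownPath F ν' ν l.reverse

/-- ai-paths: paths, closed under concatenation (in distinct edges) at
interaction and cointeraction vertices. -/
inductive AIPath (F : PreFlow) : VPt → VPt → List ℕ → Prop
  | single {ν ν' : VPt} {l : List ℕ} : IsPath F ν ν' l → AIPath F ν ν' l
  | join {ν ν' : VPt} {v : ℕ} {l₁ l₂ : List ℕ} {e e' : ℕ} :
      v ∈ F.V → (F.η v = .aiDown ∨ F.η v = .aiUp) →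
      AIPath F ν (.ver v) (l₁ ++ [e]) →
      AIPath F (.ver v) ν' (e' :: l₂) →
      e ≠ e' →
      AIPath F ν ν' (l₁ ++ [e] ++ e' :: l₂)

/-- The flow contains an ai-cycle: an ai-path from a vertex to itself in
which no edge appears twice. -/
def HasAICycle (F : PreFlow) : Prop :=
  ∃ v l, v ∈ F.V ∧ AIPath F (.ver v) (.ver v) l ∧ l.Nodup

def CycleFree (F : PreFlow) : Prop := ¬ HasAICycle F

/-- An ai-connection: a path from an interaction vertex to a cointeraction
vertex or vice versa. -/
def IsConnection (F : PreFlow) (l : List ℕ) : Prop :=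
  ∃ v v', v ∈ F.V ∧ v' ∈ F.V ∧
    ((F.η v = .aiDown ∧ F.η v' = .aiUp) ∨
     (F.η v = .aiUp ∧ F.η v' = .aiDown)) ∧
    IsPath F (.ver v) (.ver v') l

/-- A simple edge: an ai-connection consisting of a single edge. -/
def SimpleEdge (F : PreFlow) (e : ℕ) : Prop := IsConnection F [e]

/-- A clean path: an ai-path all of whose ai-connections are simple edges. -/
def IsCleanPath (F : PreFlow) (ν ν' : VPt) (l : List ℕ) : Prop :=
  AIPath F ν ν' l ∧
  ∀ l₁ l₂ l₃, l = l₁ ++ l₂ ++ l₃ → IsConnection F l₂ → l₂.length = 1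

/-! ### Local flow reduction rules. -/

open PreFlow

/-- Rule `w↓-c↓`: a weakening feeding a contraction is erased, merging the
contraction's other two edges. -/
def RedWdCd (A B : PreFlow) : Prop :=
  ∃ v₁ v₂ e e₂ e₃,
    v₁ ∈ A.V ∧ v₂ ∈ A.V ∧ v₁ ≠ v₂ ∧
    A.η v₁ = .awDown ∧ A.η v₂ = .acDown ∧
    e ∈ A.E ∧ e₂ ∈ A.E ∧ e₃ ∈ A.E ∧ e ≠ e₂ ∧ e ≠ e₃ ∧ e₂ ≠ e₃ ∧
    A.up e = some v₁ ∧ A.lo e = some v₂ ∧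
    A.lo e₂ = some v₂ ∧ A.up e₃ = some v₂ ∧
    B.V = (A.V.erase v₁).erase v₂ ∧
    B.E = (A.E.erase e).erase e₃ ∧
    B.η = A.η ∧ B.up = A.up ∧
    B.lo = Function.update A.lo e₂ (A.lo e₃)

/-- Rule `c↑-w↑` (dual of `w↓-c↓`). -/
def RedCuWu (A B : PreFlow) : Prop :=
  ∃ v₁ v₂ e e₂ e₃,
    v₁ ∈ A.V ∧ v₂ ∈ A.V ∧ v₁ ≠ v₂ ∧
    A.η v₁ = .awUp ∧ A.η v₂ = .acUp ∧
    e ∈ A.E ∧ e₂ ∈ A.E ∧ e₃ ∈ A.E ∧ e ≠ e₂ ∧ e ≠ e₃ ∧ e₂ ≠ e₃ ∧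
    A.lo e = some v₁ ∧ A.up e = some v₂ ∧
    A.up e₂ = some v₂ ∧ A.lo e₃ = some v₂ ∧
    B.V = (A.V.erase v₁).erase v₂ ∧
    B.E = (A.E.erase e).erase e₃ ∧
    B.η = A.η ∧ B.lo = A.lo ∧
    B.up = Function.update A.up e₂ (A.up e₃)

/-- Rule `w↓-i↑`: a weakening feeding a cointeraction is replaced by a
coweakening on the other cointeraction edge. -/
def RedWdIu (A B : PreFlow) : Prop :=
  ∃ v₁ v₂ e e₂,
    v₁ ∈ A.V ∧ v₂ ∈ A.V ∧ v₁ ≠ v₂ ∧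
    A.η v₁ = .awDown ∧ A.η v₂ = .aiUp ∧
    e ∈ A.E ∧ e₂ ∈ A.E ∧ e ≠ e₂ ∧
    A.up e = some v₁ ∧ A.lo e = some v₂ ∧ A.lo e₂ = some v₂ ∧
    B.V = A.V.erase v₁ ∧ B.E = A.E.erase e ∧
    B.η = Function.update A.η v₂ .awUp ∧
    B.up = A.up ∧ B.lo = A.lo

/-- Rule `i↓-w↑` (dual of `w↓-i↑`). -/
def RedIdWu (A B : PreFlow) : Prop :=
  ∃ v₁ v₂ e e₂,
    v₁ ∈ A.V ∧ v₂ ∈ A.V ∧ v₁ ≠ v₂ ∧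
    A.η v₁ = .awUp ∧ A.η v₂ = .aiDown ∧
    e ∈ A.E ∧ e₂ ∈ A.E ∧ e ≠ e₂ ∧
    A.lo e = some v₁ ∧ A.up e = some v₂ ∧ A.up e₂ = some v₂ ∧
    B.V = A.V.erase v₁ ∧ B.E = A.E.erase e ∧
    B.η = Function.update A.η v₂ .awDown ∧
    B.up = A.up ∧ B.lo = A.lo

/-- Rule `w↓-w↑`: a weakening joined to a coweakening is erased. -/
def RedWdWu (A B : PreFlow) : Prop :=
  ∃ v₁ v₂ e,
    v₁ ∈ A.V ∧ v₂ ∈ A.V ∧ v₁ ≠ v₂ ∧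
    A.η v₁ = .awDown ∧ A.η v₂ = .awUp ∧
    e ∈ A.E ∧ A.up e = some v₁ ∧ A.lo e = some v₂ ∧
    B.V = (A.V.erase v₁).erase v₂ ∧ B.E = A.E.erase e ∧
    B.η = A.η ∧ B.up = A.up ∧ B.lo = A.lo

/-- Rule `w↓-c↑`: a weakening feeding a cocontraction is replaced by two
weakenings. -/
def RedWdCu (A B : PreFlow) : Prop :=
  ∃ v₁ v₂ e e₁ e₂,
    v₁ ∈ A.V ∧ v₂ ∈ A.V ∧ v₁ ≠ v₂ ∧
    A.η v₁ = .awDown ∧ A.η v₂ = .acUp ∧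
    e ∈ A.E ∧ e₁ ∈ A.E ∧ e₂ ∈ A.E ∧ e ≠ e₁ ∧ e ≠ e₂ ∧ e₁ ≠ e₂ ∧
    A.up e = some v₁ ∧ A.lo e = some v₂ ∧
    A.up e₁ = some v₂ ∧ A.up e₂ = some v₂ ∧
    B.V = A.V ∧ B.E = A.E.erase e ∧
    B.η = Function.update A.η v₂ .awDown ∧
    B.up = Function.update A.up e₁ (some v₁) ∧
    B.lo = A.lo

/-- Rule `c↓-w↑` (dual of `w↓-c↑`). -/
def RedCdWu (A B : PreFlow) : Prop :=
  ∃ v₁ v₂ e e₁ e₂,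
    v₁ ∈ A.V ∧ v₂ ∈ A.V ∧ v₁ ≠ v₂ ∧
    A.η v₁ = .awUp ∧ A.η v₂ = .acDown ∧
    e ∈ A.E ∧ e₁ ∈ A.E ∧ e₂ ∈ A.E ∧ e ≠ e₁ ∧ e ≠ e₂ ∧ e₁ ≠ e₂ ∧
    A.lo e = some v₁ ∧ A.up e = some v₂ ∧
    A.lo e₁ = some v₂ ∧ A.lo e₂ = some v₂ ∧
    B.V = A.V ∧ B.E = A.E.erase e ∧
    B.η = Function.update A.η v₂ .awUp ∧
    B.lo = Function.update A.lo e₁ (some v₁) ∧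
    B.up = A.up

/-- Rule `c↓-i↑`: a contraction whose output edge enters a cointeraction is
replaced by a cocontraction on the other cointeraction edge followed by two
cointeractions. -/
def RedCdIu (A B : PreFlow) : Prop :=
  ∃ v₁ v₂ v₃ e e₁ e₂ e₃ g₁ g₂,
    v₁ ∈ A.V ∧ v₂ ∈ A.V ∧ v₁ ≠ v₂ ∧ v₃ ∉ A.V ∧
    A.η v₁ = .acDown ∧ A.η v₂ = .aiUp ∧
    e ∈ A.E ∧ e₁ ∈ A.E ∧ e₂ ∈ A.E ∧ e₃ ∈ A.E ∧
    e ≠ e₁ ∧ e ≠ e₂ ∧ e ≠ e₃ ∧ e₁ ≠ e₂ ∧ e₁ ≠ e₃ ∧ e₂ ≠ e₃ ∧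
    g₁ ∉ A.E ∧ g₂ ∉ A.E ∧ g₁ ≠ g₂ ∧
    A.lo e₁ = some v₁ ∧ A.lo e₂ = some v₁ ∧
    A.up e = some v₁ ∧ A.lo e = some v₂ ∧ A.lo e₃ = some v₂ ∧
    B.V = insert v₃ A.V ∧
    B.E = insert g₁ (insert g₂ (A.E.erase e)) ∧
    B.η = Function.update (Function.update A.η v₁ .acUp) v₃ .aiUp ∧
    B.up = Function.update (Function.update A.up g₁ (some v₁)) g₂ (some v₁) ∧
    B.lo = Function.update (Function.update (Function.update
      (Function.update (Function.update A.lo e₁ (some v₂)) e₂ (some v₃))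
        e₃ (some v₁)) g₁ (some v₂)) g₂ (some v₃)

/-- Rule `i↓-c↑` (dual of `c↓-i↑`). -/
def RedIdCu (A B : PreFlow) : Prop :=
  ∃ v₁ v₂ v₃ e e₁ e₂ e₃ g₁ g₂,
    v₁ ∈ A.V ∧ v₂ ∈ A.V ∧ v₁ ≠ v₂ ∧ v₃ ∉ A.V ∧
    A.η v₁ = .acUp ∧ A.η v₂ = .aiDown ∧
    e ∈ A.E ∧ e₁ ∈ A.E ∧ e₂ ∈ A.E ∧ e₃ ∈ A.E ∧
    e ≠ e₁ ∧ e ≠ e₂ ∧ e ≠ e₃ ∧ e₁ ≠ e₂ ∧ e₁ ≠ e₃ ∧ e₂ ≠ e₃ ∧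
    g₁ ∉ A.E ∧ g₂ ∉ A.E ∧ g₁ ≠ g₂ ∧
    A.up e₁ = some v₁ ∧ A.up e₂ = some v₁ ∧
    A.lo e = some v₁ ∧ A.up e = some v₂ ∧ A.up e₃ = some v₂ ∧
    B.V = insert v₃ A.V ∧
    B.E = insert g₁ (insert g₂ (A.E.erase e)) ∧
    B.η = Function.update (Function.update A.η v₁ .acDown) v₃ .aiDown ∧
    B.lo = Function.update (Function.update A.lo g₁ (some v₁)) g₂ (some v₁) ∧
    B.up = Function.update (Function.update (Function.update
      (Function.update (Function.update A.up e₁ (some v₂)) e₂ (some v₃))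
        e₃ (some v₁)) g₁ (some v₂)) g₂ (some v₃)

/-- Rule `c↓-c↑`: a contraction whose output enters a cocontraction is
replaced by two cocontractions above two contractions, crosswise connected. -/
def RedCdCu (A B : PreFlow) : Prop :=
  ∃ v₁ v₂ v₃ v₄ e e₁ e₂ e₃ e₄ g₁₁ g₁₂ g₂₁ g₂₂,
    v₁ ∈ A.V ∧ v₂ ∈ A.V ∧ v₁ ≠ v₂ ∧
    v₃ ∉ A.V ∧ v₄ ∉ A.V ∧ v₃ ≠ v₄ ∧
    A.η v₁ = .acDown ∧ A.η v₂ = .acUp ∧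
    e ∈ A.E ∧ e₁ ∈ A.E ∧ e₂ ∈ A.E ∧ e₃ ∈ A.E ∧ e₄ ∈ A.E ∧
    e ≠ e₁ ∧ e ≠ e₂ ∧ e ≠ e₃ ∧ e ≠ e₄ ∧
    e₁ ≠ e₂ ∧ e₁ ≠ e₃ ∧ e₁ ≠ e₄ ∧ e₂ ≠ e₃ ∧ e₂ ≠ e₄ ∧ e₃ ≠ e₄ ∧
    g₁₁ ∉ A.E ∧ g₁₂ ∉ A.E ∧ g₂₁ ∉ A.E ∧ g₂₂ ∉ A.E ∧
    g₁₁ ≠ g₁₂ ∧ g₁₁ ≠ g₂₁ ∧ g₁₁ ≠ g₂₂ ∧ g₁₂ ≠ g₂₁ ∧ g₁₂ ≠ g₂₂ ∧ g₂₁ ≠ g₂₂ ∧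
    A.lo e₁ = some v₁ ∧ A.lo e₂ = some v₁ ∧ A.up e = some v₁ ∧
    A.lo e = some v₂ ∧ A.up e₃ = some v₂ ∧ A.up e₄ = some v₂ ∧
    B.V = insert v₃ (insert v₄ A.V) ∧
    B.E = insert g₁₁ (insert g₁₂ (insert g₂₁ (insert g₂₂ (A.E.erase e)))) ∧
    B.η = Function.update (Function.update (Function.update
      (Function.update A.η v₁ .acUp) v₂ .acUp) v₃ .acDown) v₄ .acDown ∧
    B.up = Function.update (Function.update (Function.update
      (Function.update (Function.update (Function.update A.up
        e₃ (some v₃)) e₄ (some v₄)) g₁₁ (some v₁)) g₁₂ (some v₁))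
          g₂₁ (some v₂)) g₂₂ (some v₂) ∧
    B.lo = Function.update (Function.update (Function.update
      (Function.update (Function.update A.lo e₂ (some v₂)) g₁₁ (some v₃))
        g₁₂ (some v₄)) g₂₁ (some v₃)) g₂₂ (some v₄)

/-- One step of the flow rewriting system `w`. -/
def StepW (A B : PreFlow) : Prop :=
  RedWdCd A B ∨ RedCuWu A B ∨ RedWdIu A B ∨ RedIdWu A B ∨
  RedWdWu A B ∨ RedWdCu A B ∨ RedCdWu A B

/-- One step of the flow rewriting system `c`. -/
def StepC (A B : PreFlow) : Prop :=
  RedCdIu A B ∨ RedIdCu A B ∨ RedCdCu A B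

/-- `A` is normal for the flow rewriting system `w`. -/
def NormalW (A : PreFlow) : Prop := ¬ ∃ B, StepW A B

/-- `A` is normal for the flow rewriting system `c`. -/
def NormalC (A : PreFlow) : Prop := ¬ ∃ B, StepC A B

/-! ### Flow isomorphisms. -/

structure FlowIso (A B : PreFlow) : Type where
  vmap : ℕ → ℕ
  emap : ℕ → ℕ
  vbij : Set.BijOn vmap (A.V : Set ℕ) (B.V : Set ℕ)
  ebij : Set.BijOn emap (A.E : Set ℕ) (B.E : Set ℕ)
  lab : ∀ v ∈ A.V, B.η (vmap v) = A.η v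
  upc : ∀ e ∈ A.E, B.up (emap e) = (A.up e).map vmap
  loc : ∀ e ∈ A.E, B.lo (emap e) = (A.lo e).map vmap

/-! ### The global reduction `→se` (elimination of a simple edge). -/

/-- The flow obtained from `B` by eliminating the simple edge `e0` between
the interaction `vi` and the cointeraction `vc` (with `e2` the other lower
edge of `vi` and `e3` the other upper edge of `vc`): two copies (tags `0`,
hat, the lower one, and `1`, tilde, the upper one) of the remaining flow are
glued by identifying the hat copy of `e2` with the tilde copy of `e3`; a
weakening (vertex `(2,0)`) is placed above the tilde copy of `e2`, a
coweakening (vertex `(2,1)`) below the hat copy of `e3`; each upper edge `ε`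
of `B` gives a cocontraction (vertex `(3,ε)`, with a new upper edge `(3,ε)`)
joining the two copies of `ε`, and dually each lower edge `ε'` of `B` gives
a contraction (vertex `(4,ε')`, with a new lower edge `(4,ε')`). -/
def seFlow (B : PreFlow) (vi vc e0 e2 e3 : ℕ) : PreFlow :=
  { V := ((B.V.erase vi).erase vc).image (Nat.pair 0) ∪
         ((B.V.erase vi).erase vc).image (Nat.pair 1) ∪
         {Nat.pair 2 0, Nat.pair 2 1} ∪
         (B.E.filter (fun e => B.up e = none)).image (Nat.pair 3) ∪
         (B.E.filter (fun e => B.lo e = none)).image (Nat.pair 4),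
    E := (B.E.erase e0).image (Nat.pair 0) ∪
         (B.E.erase e0).image (fun e => if e = e3 then Nat.pair 0 e2 else Nat.pair 1 e) ∪
         (B.E.filter (fun e => B.up e = none)).image (Nat.pair 3) ∪
         (B.E.filter (fun e => B.lo e = none)).image (Nat.pair 4),
    η := fun x =>
      if (Nat.unpair x).1 = 2 then
        (if (Nat.unpair x).2 = 0 then FlowLabel.awDown else FlowLabel.awUp)
      else if (Nat.unpair x).1 = 3 then FlowLabel.acUp
      else if (Nat.unpair x).1 = 4 then FlowLabel.acDown
      else B.η (Nat.unpair x).2,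
    up := fun x =>
      let t := (Nat.unpair x).1
      let y := (Nat.unpair x).2
      if t = 0 then
        (if y = e2 then
          (match B.up e3 with
           | some v => some (Nat.pair 1 v)
           | none => some (Nat.pair 3 e3))
        else
          (match B.up y with
           | some v => some (Nat.pair 0 v)
           | none => some (Nat.pair 3 y)))
      else if t = 1 then
        (if y = e2 then some (Nat.pair 2 0)
        else
          (match B.up y with
           | some v => some (Nat.pair 1 v)
           | none => some (Nat.pair 3 y)))
      else if t = 3 then none
      else some (Nat.pair 4 y),
    lo := fun x =>
      let t := (Nat.unpair x).1
      let y := (Nat.unpair x).2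
      if t = 0 then
        (if y = e2 then
          (match B.lo e2 with
           | some v => some (Nat.pair 0 v)
           | none => some (Nat.pair 4 e2))
        else if y = e3 then some (Nat.pair 2 1)
        else
          (match B.lo y with
           | some v => some (Nat.pair 0 v)
           | none => some (Nat.pair 4 y)))
      else if t = 1 then
        (match B.lo y with
         | some v => some (Nat.pair 1 v)
         | none => some (Nat.pair 4 y))
      else if t = 3 then some (Nat.pair 3 y)
      else none }

/-- The reduction `→se`: elimination of a simple edge (up to flow
isomorphism). -/
def RedSE (B C : PreFlow) : Prop :=
  ∃ vi vc e0 e2 e3,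
    vi ∈ B.V ∧ vc ∈ B.V ∧ vi ≠ vc ∧
    B.η vi = .aiDown ∧ B.η vc = .aiUp ∧
    e0 ∈ B.E ∧ e2 ∈ B.E ∧ e3 ∈ B.E ∧
    e0 ≠ e2 ∧ e0 ≠ e3 ∧ e2 ≠ e3 ∧
    B.up e0 = some vi ∧ B.lo e0 = some vc ∧
    B.up e2 = some vi ∧ B.lo e3 = some vc ∧
    Nonempty (FlowIso C (seFlow B vi vc e0 e2 e3))

/-! ### The atomic flow associated with a derivation. -/

/-- Correspondence conditions for a linear rule applied at position `q`:
for each pair `(c₁, c₂)` in `cs`, occurrences at `q ++ c₁ ++ p` in the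
conclusion (formula `i+1`) are traced to occurrences at `q ++ c₂ ++ p` in
the premiss (formula `i`). -/
def corrCond (f : ℕ → List Bool → ℕ) (i : ℕ) (q : List Bool) (ψ : Formula)
    (cs : List (List Bool × List Bool)) : Prop :=
  ∀ c ∈ cs, ∀ p : List Bool, ψ.IsOcc (q ++ c.1 ++ p) →
    f (i + 1) (q ++ c.1 ++ p) = f i (q ++ c.2 ++ p)

/-- The tracing conditions for one inference step: occurrences in the
context are traced to the same edge, and the active occurrences of a
structural rule are related to the edges of the vertex `v` as prescribed by
its label, while the active occurrences of logical and `=` steps are traced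
to the same edges under the canonical correspondence. -/
def stepCond (A : PreFlow) (f : ℕ → List Bool → ℕ) (v : ℕ) (i : ℕ)
    (r : RuleName) (q : List Bool) (φ ψ : Formula) : Prop :=
  (∀ p, ¬ (q <+: p) → φ.IsOcc p → f (i + 1) p = f i p) ∧
  match r with
  | .aiDown =>
      A.η v = .aiDown ∧
      A.up (f (i + 1) (q ++ [false])) = some v ∧
      A.up (f (i + 1) (q ++ [true])) = some v ∧
      f (i + 1) (q ++ [false]) ≠ f (i + 1) (q ++ [true])
  | .aiUp =>
      A.η v = .aiUp ∧
      A.lo (f i (q ++ [false])) = some v ∧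
      A.lo (f i (q ++ [true])) = some v ∧
      f i (q ++ [false]) ≠ f i (q ++ [true])
  | .awDown => A.η v = .awDown ∧ A.up (f (i + 1) q) = some v
  | .awUp => A.η v = .awUp ∧ A.lo (f i q) = some v
  | .acDown =>
      A.η v = .acDown ∧
      A.lo (f i (q ++ [false])) = some v ∧
      A.lo (f i (q ++ [true])) = some v ∧
      A.up (f (i + 1) q) = some v ∧
      f i (q ++ [false]) ≠ f i (q ++ [true])
  | .acUp =>
      A.η v = .acUp ∧
      A.lo (f i q) = some v ∧
      A.up (f (i + 1) (q ++ [false])) = some v ∧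
      A.up (f (i + 1) (q ++ [true])) = some v ∧
      f (i + 1) (q ++ [false]) ≠ f (i + 1) (q ++ [true])
  | .s => corrCond f i q ψ
      [([false, false], [false]), ([false, true], [true, false]),
       ([true], [true, true])]
  | .m => corrCond f i q ψ
      [([false, false], [false, false]), ([true, false], [false, true]),
       ([false, true], [true, false]), ([true, true], [true, true])]
  | .eqOrComm => corrCond f i q ψ [([false], [true]), ([true], [false])]
  | .eqAndComm => corrCond f i q ψ [([false], [true]), ([true], [false])]
  | .eqOrAssocL => corrCond f i q ψ
      [([false], [false, false]), ([true, false], [false, true]),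
       ([true, true], [true])]
  | .eqOrAssocR => corrCond f i q ψ
      [([false, false], [false]), ([false, true], [true, false]),
       ([true], [true, true])]
  | .eqAndAssocL => corrCond f i q ψ
      [([false], [false, false]), ([true, false], [false, true]),
       ([true, true], [true])]
  | .eqAndAssocR => corrCond f i q ψ
      [([false, false], [false]), ([false, true], [true, false]),
       ([true], [true, true])]
  | .eqOrUnitDel => corrCond f i q ψ [([], [false])]
  | .eqOrUnitAdd => corrCond f i q ψ [([false], [])]
  | .eqAndUnitDel => corrCond f i q ψ [([], [false])]
  | .eqAndUnitAdd => corrCond f i q ψ [([false], [])]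
  | .eqTTDel => True
  | .eqTTAdd => True
  | .eqFFDel => True
  | .eqFFAdd => True

/-- `A` is the atomic flow associated with the derivation `Φ`, where `f`
maps each atom occurrence (formula index, position) of `Φ` to an edge of
`A`, and `g` assigns to each structural inference step its vertex. -/
def IsAssocFlow (Φ : Deriv) (A : PreFlow) (f : ℕ → List Bool → ℕ)
    (g : ℕ → ℕ) : Prop :=
  Φ.WF ∧ A.IsFlow ∧
  (∀ i p, i < Φ.nf → (Φ.fml i).IsOcc p → f i p ∈ A.E) ∧
  (∀ e ∈ A.E, ∃ i p, i < Φ.nf ∧ (Φ.fml i).IsOcc p ∧ f i p = e) ∧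
  (∀ i p p', i < Φ.nf → (Φ.fml i).IsOcc p → (Φ.fml i).IsOcc p' →
    f i p = f i p' → p = p') ∧
  (∀ p, (Φ.fml 0).IsOcc p → A.up (f 0 p) = none) ∧
  (∀ p, (Φ.fml Φ.steps.length).IsOcc p → A.lo (f Φ.steps.length p) = none) ∧
  (∀ i, i < Φ.steps.length → (Φ.stepAt i).1.isStructural = true → g i ∈ A.V) ∧
  (∀ v ∈ A.V, ∃ i, i < Φ.steps.length ∧
    (Φ.stepAt i).1.isStructural = true ∧ g i = v) ∧
  (∀ i j, i < Φ.steps.length → j < Φ.steps.length →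
    (Φ.stepAt i).1.isStructural = true → (Φ.stepAt j).1.isStructural = true →
    g i = g j → i = j) ∧
  (∀ i, i < Φ.steps.length →
    stepCond A f (g i) i (Φ.stepAt i).1 (Φ.stepAt i).2.1
      (Φ.fml i) (Φ.fml (i + 1)))

/-! ### Streamlining. -/

/-- No path from an interaction or weakening vertex to a cointeraction or
coweakening vertex. -/
def NoIWPath (A : PreFlow) : Prop :=
  ¬ ∃ v v' l, v ∈ A.V ∧ v' ∈ A.V ∧
      (A.η v = .aiDown ∨ A.η v = .awDown) ∧
      (A.η v' = .aiUp ∨ A.η v' = .awUp) ∧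
      IsPath A (.ver v) (.ver v') l

/-- `Φ` is a streamlined derivation. -/
def Streamlined (Φ : Deriv) : Prop :=
  ∃ A f g, IsAssocFlow Φ A f g ∧ NoIWPath A

/-- `Φ` is a super-streamlined derivation. -/
def SuperStreamlined (Φ : Deriv) : Prop :=
  ∃ A f g, IsAssocFlow Φ A f g ∧ NoIWPath A ∧ NormalW A

/-- `Φ` is a hyper-streamlined derivation. -/
def HyperStreamlined (Φ : Deriv) : Prop :=
  ∃ A f g, IsAssocFlow Φ A f g ∧ NoIWPath A ∧ NormalW A ∧ NormalC A

end AF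

namespace AF

/-! ### Negation, evaluation and the deep-inference closure -/

namespace Formula

/-- De Morgan dual with complemented atoms. -/
def neg : Formula → Formula
  | .tt => .ff
  | .ff => .tt
  | .atom n b => .atom n (!b)
  | .or α β => .and (neg α) (neg β)
  | .and α β => .or (neg α) (neg β)

@[simp] theorem neg_neg (φ : Formula) : φ.neg.neg = φ := by
  induction φ <;> simp_all [neg]

/-- Truth of a formula under a valuation of the variables. -/
def Holds (v : ℕ → Bool) : Formula → Prop
  | .tt => True
  | .ff => False
  | .atom n b => v n = b
  | .or α β => Holds v α ∨ Holds v β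
  | .and α β => Holds v α ∧ Holds v β

theorem holds_neg (v : ℕ → Bool) (φ : Formula) : φ.neg.Holds v ↔ ¬ φ.Holds v := by
  induction φ with
  | atom n b => simp [neg, Holds, Bool.eq_not]
  | _ => simp_all [neg, Holds]; try tauto

end Formula

/-- Application of a rule at a position, presented as closure under contexts. -/
inductive CStep (r : RuleName) : List Bool → Formula → Formula → Prop
  | root {γ δ : Formula} : RuleInstance r γ δ → CStep r [] γ δ
  | orL {q : List Bool} {α α' : Formula} (β : Formula) :
      CStep r q α α' → CStep r (false :: q) (.or α β) (.or α' β)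
  | orR {q : List Bool} {β β' : Formula} (α : Formula) :
      CStep r q β β' → CStep r (true :: q) (.or α β) (.or α β')
  | andL {q : List Bool} {α α' : Formula} (β : Formula) :
      CStep r q α α' → CStep r (false :: q) (.and α β) (.and α' β)
  | andR {q : List Bool} {β β' : Formula} (α : Formula) :
      CStep r q β β' → CStep r (true :: q) (.and α β) (.and α β')

theorem CStep.stepAt {r : RuleName} {q : List Bool} {φ ψ : Formula} (h : CStep r q φ ψ) :
    StepAt r q φ ψ := by
  induction h with
  | root h => exact ⟨_, _, by simp [Formula.sub], h, by simp [Formula.repl]⟩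
  | _ _ _ ih =>
    obtain ⟨γ, δ, h1, h2, h3⟩ := ih
    exact ⟨γ, δ, by simpa [Formula.sub] using h1, h2, by simp [Formula.repl, h3]⟩

theorem StepAt.cstep {r : RuleName} {q : List Bool} {φ ψ : Formula} (h : StepAt r q φ ψ) :
    CStep r q φ ψ := by
  induction q generalizing φ ψ with
  | nil =>
    obtain ⟨γ, δ, h1, h2, h3⟩ := h
    simp only [Formula.sub, Option.some.injEq] at h1
    subst h1
    simp only [Formula.repl] at h3
    subst h3
    exact .root h2
  | cons b q ih =>
    obtain ⟨γ, δ, h1, h2, h3⟩ := h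
    cases φ <;> cases b <;> simp only [Formula.sub, Formula.repl, reduceCtorEq] at h1 h3 <;>
      subst h3
    · exact .orL _ (ih ⟨γ, δ, h1, h2, rfl⟩)
    · exact .orR _ (ih ⟨γ, δ, h1, h2, rfl⟩)
    · exact .andL _ (ih ⟨γ, δ, h1, h2, rfl⟩)
    · exact .andR _ (ih ⟨γ, δ, h1, h2, rfl⟩)

theorem CStep.sound {r : RuleName} {q : List Bool} {φ ψ : Formula} (h : CStep r q φ ψ)
    (v : ℕ → Bool) (hφ : φ.Holds v) : ψ.Holds v := by
  induction h with
  | root h => cases h <;> simp_all [Formula.Holds, Bool.eq_not] <;> tauto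
  | _ => simp_all [Formula.Holds]; try tauto

theorem Deriv.WF.sound {Φ : Deriv} (hΦ : Φ.WF) (v : ℕ → Bool) (h : Φ.prem.Holds v) :
    Φ.concl.Holds v := by
  have key : ∀ i ≤ Φ.steps.length, (Φ.fml i).Holds v := by
    intro i
    induction i with
    | zero => intro _; simpa [Deriv.fml] using h
    | succ i ih => intro hi; exact (hΦ i hi).cstep.sound v (ih (by omega))
  exact key _ le_rfl

/-! ### Closure properties of derivability -/

section Derives

instance (S : Set RuleName) : Trans (Derives S) (Derives S) (Derives S) :=
  ⟨Relation.ReflTransGen.trans⟩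

variable {S T : Set RuleName} {α α' β β' γ φ ψ : Formula}

theorem Derives.of_rule {r : RuleName} (hr : r ∈ S) (h : RuleInstance r φ ψ) :
    Derives S φ ψ :=
  .single ⟨r, hr, [], (CStep.root h).stepAt⟩

theorem Derives.map (h : Derives S α β) (f : Formula → Formula)
    (hf : ∀ x y, Step S x y → Step S (f x) (f y)) : Derives S (f α) (f β) := by
  induction h with
  | refl => exact .refl
  | tail _ h ih => exact ih.tail (hf _ _ h)

theorem Derives.orL (h : Derives S α α') (β : Formula) :
    Derives S (.or α β) (.or α' β) :=
  h.map (fun x => .or x β)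
    (fun _ _ ⟨r, hr, q, h⟩ => ⟨r, hr, false :: q, (h.cstep.orL β).stepAt⟩)

theorem Derives.orR (h : Derives S β β') (α : Formula) :
    Derives S (.or α β) (.or α β') :=
  h.map (fun x => .or α x)
    (fun _ _ ⟨r, hr, q, h⟩ => ⟨r, hr, true :: q, (h.cstep.orR α).stepAt⟩)

theorem Derives.andL (h : Derives S α α') (β : Formula) :
    Derives S (.and α β) (.and α' β) :=
  h.map (fun x => .and x β)
    (fun _ _ ⟨r, hr, q, h⟩ => ⟨r, hr, false :: q, (h.cstep.andL β).stepAt⟩)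

theorem Derives.andR (h : Derives S β β') (α : Formula) :
    Derives S (.and α β) (.and α β') :=
  h.map (fun x => .and α x)
    (fun _ _ ⟨r, hr, q, h⟩ => ⟨r, hr, true :: q, (h.cstep.andR α).stepAt⟩)

theorem Derives.or (h : Derives S α α') (h' : Derives S β β') :
    Derives S (.or α β) (.or α' β') :=
  (h.orL β).trans (h'.orR α')

theorem Derives.and (h : Derives S α α') (h' : Derives S β β') :
    Derives S (.and α β) (.and α' β') :=
  (h.andL β).trans (h'.andR α')

theorem CStep.derives {r : RuleName} {q : List Bool}
    (h : CStep r q φ ψ) (hroot : ∀ γ δ, RuleInstance r γ δ → Derives S γ δ) :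
    Derives S φ ψ := by
  induction h with
  | root h => exact hroot _ _ h
  | orL β _ ih => exact ih.orL β
  | orR α _ ih => exact ih.orR α
  | andL β _ ih => exact ih.andL β
  | andR α _ ih => exact ih.andR α

/-- `S` contains all logical and `=` rules. -/
def HasLinear (S : Set RuleName) : Prop := ∀ r : RuleName, r.isStructural = false → r ∈ S

theorem HasLinear.derives (hS : HasLinear S) {r : RuleName} (h : RuleInstance r φ ψ)
    (hr : r.isStructural = false) : Derives S φ ψ :=
  .of_rule (hS r hr) h

theorem HasLinear.switch_right (hS : HasLinear S) (α β γ : Formula) :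
    Derives S (.and (.or α β) γ) (.or α (.and β γ)) :=
  calc
    Derives S (.and (.or α β) γ) (.and γ (.or α β)) := hS.derives (.eqAndComm _ _) rfl
    Derives S _ (.and γ (.or β α)) := (hS.derives (.eqOrComm _ _) rfl).andR _
    Derives S _ (.or (.and γ β) α) := hS.derives (.s _ _ _) rfl
    Derives S _ (.or α (.and γ β)) := hS.derives (.eqOrComm _ _) rfl
    Derives S _ (.or α (.and β γ)) := (hS.derives (.eqAndComm _ _) rfl).orR _

end Derives

end AF

namespace AF

/-! ### Duality -/

/-- The dual rule (for switch, up to `=`). -/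
def RuleName.dual : RuleName → RuleName
  | .aiDown => .aiUp
  | .aiUp => .aiDown
  | .awDown => .awUp
  | .awUp => .awDown
  | .acDown => .acUp
  | .acUp => .acDown
  | .s => .s
  | .m => .m
  | .eqOrComm => .eqAndComm
  | .eqAndComm => .eqOrComm
  | .eqOrAssocL => .eqAndAssocR
  | .eqOrAssocR => .eqAndAssocL
  | .eqAndAssocL => .eqOrAssocR
  | .eqAndAssocR => .eqOrAssocL
  | .eqOrUnitDel => .eqAndUnitAdd
  | .eqOrUnitAdd => .eqAndUnitDel
  | .eqAndUnitDel => .eqOrUnitAdd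
  | .eqAndUnitAdd => .eqOrUnitDel
  | .eqTTDel => .eqFFAdd
  | .eqTTAdd => .eqFFDel
  | .eqFFDel => .eqTTAdd
  | .eqFFAdd => .eqTTDel

theorem RuleInstance.neg {r : RuleName} {φ ψ : Formula} (h : RuleInstance r φ ψ) (hr : r ≠ .s) :
    RuleInstance r.dual ψ.neg φ.neg := by
  cases h
  case s => exact absurd rfl hr
  all_goals
    simp only [RuleName.dual, Formula.neg]
    constructor

theorem CStep.derives_neg {S : Set RuleName} {r : RuleName} {q : List Bool} {φ ψ : Formula}
    (h : CStep r q φ ψ) (hr : r.dual ∈ S) (hs : r = .s → HasLinear S) :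
    Derives S ψ.neg φ.neg := by
  induction h with
  | root h =>
    by_cases hrs : r = .s
    · have hS := hs hrs
      subst hrs
      cases h
      exact hS.switch_right _ _ _
    · exact .of_rule hr (h.neg hrs)
  | orL β _ ih => exact ih.andL _
  | orR α _ ih => exact ih.andR _
  | andL β _ ih => exact ih.orL _
  | andR α _ ih => exact ih.orR _

theorem Derives.neg {S T : Set RuleName} {φ ψ : Formula} (h : Derives S φ ψ)
    (hT : ∀ r ∈ S, r.dual ∈ T) (hs : .s ∈ S → HasLinear T) : Derives T ψ.neg φ.neg := by
  induction h with
  | refl => exact .refl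
  | tail _ h ih =>
    obtain ⟨r, hr, q, h⟩ := h
    exact (h.cstep.derives_neg (hT r hr) fun e => hs (e ▸ hr)).trans ih

/-! ### The up and down fragments -/

/-- The rules other than interaction and weakening. -/
def upRules : Set RuleName := {r | r ≠ .aiDown ∧ r ≠ .awDown}

/-- The rules other than cointeraction and coweakening. -/
def downRules : Set RuleName := {r | r ≠ .aiUp ∧ r ≠ .awUp}

/-- The rules of the up fragment other than coweakening. -/
def upCore : Set RuleName := {r | r ≠ .aiDown ∧ r ≠ .awDown ∧ r ≠ .awUp}

/-- The rules of the down fragment other than weakening. -/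
def downCore : Set RuleName := {r | r ≠ .aiUp ∧ r ≠ .awUp ∧ r ≠ .awDown}

theorem hasLinear_upRules : HasLinear upRules := by
  intro r hr; cases r <;> simp_all [upRules, RuleName.isStructural]

theorem hasLinear_downRules : HasLinear downRules := by
  intro r hr; cases r <;> simp_all [downRules, RuleName.isStructural]

theorem hasLinear_upCore : HasLinear upCore := by
  intro r hr; cases r <;> simp_all [upCore, RuleName.isStructural]

theorem hasLinear_downCore : HasLinear downCore := by
  intro r hr; cases r <;> simp_all [downCore, RuleName.isStructural]

theorem Derives.neg_up {φ ψ : Formula} (h : Derives upRules φ ψ) :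
    Derives downRules ψ.neg φ.neg :=
  h.neg (by intro r hr; cases r <;> simp_all [upRules, downRules, RuleName.dual])
    fun _ => hasLinear_downRules

theorem Derives.neg_down {φ ψ : Formula} (h : Derives downRules φ ψ) :
    Derives upRules ψ.neg φ.neg :=
  h.neg (by intro r hr; cases r <;> simp_all [upRules, downRules, RuleName.dual])
    fun _ => hasLinear_upRules

/-! ### General cocontraction, coweakening and distribution -/

theorem HasLinear.ff_tt {S : Set RuleName} (hS : HasLinear S) : Derives S .ff .tt :=
  calc
    Derives S .ff (.and .ff .tt) := hS.derives (.eqAndUnitAdd _) rfl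
    Derives S _ (.and .ff (.or .tt .tt)) := (hS.derives .eqTTAdd rfl).andR _
    Derives S _ (.or (.and .ff .tt) .tt) := hS.derives (.s _ _ _) rfl
    Derives S _ (.or .ff .tt) := (hS.derives (.eqAndUnitDel _) rfl).orL _
    Derives S _ (.or .tt .ff) := hS.derives (.eqOrComm _ _) rfl
    Derives S _ .tt := hS.derives (.eqOrUnitDel _) rfl

theorem up_tt (φ : Formula) : Derives upRules φ .tt := by
  have hS := hasLinear_upRules
  induction φ with
  | tt => exact .refl
  | ff => exact hS.ff_tt
  | atom n b => exact .of_rule (r := .awUp) (by simp [upRules]) (.awUp n b)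
  | or α β hα hβ => exact (hα.or hβ).trans (hS.derives .eqTTDel rfl)
  | and α β hα hβ => exact (hα.and hβ).trans (hS.derives (.eqAndUnitDel _) rfl)

theorem HasLinear.and_and_comm {S : Set RuleName} (hS : HasLinear S) (α β γ δ : Formula) :
    Derives S (.and (.and α β) (.and γ δ)) (.and (.and α γ) (.and β δ)) :=
  calc
    Derives S (.and (.and α β) (.and γ δ)) (.and α (.and β (.and γ δ))) :=
      hS.derives (.eqAndAssocL _ _ _) rfl
    Derives S _ (.and α (.and (.and β γ) δ)) := (hS.derives (.eqAndAssocR _ _ _) rfl).andR _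
    Derives S _ (.and α (.and (.and γ β) δ)) := ((hS.derives (.eqAndComm _ _) rfl).andL _).andR _
    Derives S _ (.and α (.and γ (.and β δ))) := (hS.derives (.eqAndAssocL _ _ _) rfl).andR _
    Derives S _ (.and (.and α γ) (.and β δ)) := hS.derives (.eqAndAssocR _ _ _) rfl

theorem up_dup (φ : Formula) : Derives upRules φ (.and φ φ) := by
  have hS := hasLinear_upRules
  induction φ with
  | tt => exact hS.derives (.eqAndUnitAdd _) rfl
  | ff => exact hS.derives .eqFFAdd rfl
  | atom n b => exact .of_rule (r := .acUp) (by simp [upRules]) (.acUp n b)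
  | or α β hα hβ => exact (hα.or hβ).trans (hS.derives (.m _ _ _ _) rfl)
  | and α β hα hβ => exact (hα.and hβ).trans (hS.and_and_comm _ _ _ _)

theorem up_and_left (α β : Formula) : Derives upRules (.and α β) α :=
  ((up_tt β).andR α).trans (hasLinear_upRules.derives (.eqAndUnitDel _) rfl)

theorem up_and_right (α β : Formula) : Derives upRules (.and α β) β :=
  .trans (hasLinear_upRules.derives (.eqAndComm _ _) rfl) (up_and_left β α)

theorem up_and_intro {φ α β : Formula} (hα : Derives upRules φ α) (hβ : Derives upRules φ β) :
    Derives upRules φ (.and α β) :=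
  (up_dup φ).trans (hα.and hβ)

theorem up_distrib (γ α β : Formula) :
    Derives upRules (.and γ (.or α β)) (.or (.and γ α) (.and γ β)) :=
  have hS := hasLinear_upRules
  calc
    Derives upRules (.and γ (.or α β)) (.and (.and γ γ) (.or α β)) := (up_dup γ).andL _
    Derives upRules _ (.and γ (.and γ (.or α β))) := hS.derives (.eqAndAssocL _ _ _) rfl
    Derives upRules _ (.and γ (.or (.and γ α) β)) := (hS.derives (.s _ _ _) rfl).andR _
    Derives upRules _ (.and γ (.or β (.and γ α))) := (hS.derives (.eqOrComm _ _) rfl).andR _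
    Derives upRules _ (.or (.and γ β) (.and γ α)) := hS.derives (.s _ _ _) rfl
    Derives upRules _ (.or (.and γ α) (.and γ β)) := hS.derives (.eqOrComm _ _) rfl

theorem up_ff_of_compl {φ : Formula} {n : ℕ} {b : Bool} (h : Derives upRules φ (.atom n b))
    (h' : Derives upRules φ (.atom n !b)) : Derives upRules φ .ff :=
  (up_and_intro h h').trans (Derives.of_rule (r := .aiUp) (by simp [upRules]) (.aiUp n b))

theorem down_ff (φ : Formula) : Derives downRules .ff φ := by
  simpa [Formula.neg] using (up_tt φ.neg).neg_up

theorem down_or_elim {α β ψ : Formula} (hα : Derives downRules α ψ)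
    (hβ : Derives downRules β ψ) : Derives downRules (.or α β) ψ := by
  simpa [Formula.neg] using (up_and_intro hα.neg_down hβ.neg_down).neg_up

/-! ### Completeness of up-then-down derivations -/

/-- Derivability by an up derivation followed by a down derivation. -/
def UpDown (φ ψ : Formula) : Prop := ∃ θ, Derives upRules φ θ ∧ Derives downRules θ ψ

theorem UpDown.up {φ φ' ψ : Formula} (h : Derives upRules φ φ') (h' : UpDown φ' ψ) :
    UpDown φ ψ :=
  let ⟨θ, h1, h2⟩ := h'
  ⟨θ, h.trans h1, h2⟩

theorem UpDown.neg {φ ψ : Formula} (h : UpDown φ ψ) : UpDown ψ.neg φ.neg :=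
  let ⟨θ, h1, h2⟩ := h
  ⟨θ.neg, h2.neg_down, h1.neg_up⟩

theorem UpDown.or_elim {α β ψ : Formula} (hα : UpDown α ψ) (hβ : UpDown β ψ) :
    UpDown (.or α β) ψ :=
  let ⟨θ, h1, h2⟩ := hα
  let ⟨θ', h1', h2'⟩ := hβ
  ⟨.or θ θ', h1.or h1', down_or_elim h2 h2'⟩

theorem UpDown.of_up_ff {φ : Formula} (h : Derives upRules φ .ff) (ψ : Formula) : UpDown φ ψ :=
  ⟨.ff, h, down_ff ψ⟩

/-- Conjunction of a list of literals. -/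
def litConj : List (ℕ × Bool) → Formula
  | [] => .tt
  | (n, b) :: L => .and (.atom n b) (litConj L)

theorem up_litConj_mem {L : List (ℕ × Bool)} {n : ℕ} {b : Bool} (h : (n, b) ∈ L) :
    Derives upRules (litConj L) (.atom n b) := by
  induction L with
  | nil => simp at h
  | cons l L ih =>
    rcases List.mem_cons.1 h with rfl | h
    · exact up_and_left _ _
    · exact (up_and_right _ _).trans (ih h)

theorem HasLinear.litConj_append {S : Set RuleName} (hS : HasLinear S)
    (L M : List (ℕ × Bool)) :
    Derives S (.and (litConj L) (litConj M)) (litConj (L ++ M)) := by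
  induction L with
  | nil =>
    exact .trans (hS.derives (.eqAndComm _ _) rfl) (hS.derives (.eqAndUnitDel _) rfl)
  | cons l L ih => exact .trans (hS.derives (.eqAndAssocL _ _ _) rfl) (ih.andR _)

/-- Disjunctive normal form. -/
def Formula.dnf : Formula → List (List (ℕ × Bool))
  | .tt => [[]]
  | .ff => []
  | .atom n b => [[(n, b)]]
  | .or α β => α.dnf ++ β.dnf
  | .and α β => β.dnf.flatMap fun M => α.dnf.map fun L => M ++ L

theorem Formula.holds_of_mem_dnf {v : ℕ → Bool} {φ : Formula} {L : List (ℕ × Bool)}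
    (hL : L ∈ φ.dnf) (h : ∀ l ∈ L, v l.1 = l.2) : φ.Holds v := by
  induction φ generalizing L with
  | tt => trivial
  | ff => simp [dnf] at hL
  | atom n b => simp_all [dnf, Holds]
  | or α β hα hβ =>
    rcases List.mem_append.1 hL with hL | hL
    · exact .inl (hα hL h)
    · exact .inr (hβ hL h)
  | and α β hα hβ =>
    obtain ⟨M, hM, hL⟩ := List.mem_flatMap.1 hL
    obtain ⟨L, hL', rfl⟩ := List.mem_map.1 hL
    simp only [List.mem_append] at h
    exact ⟨hα hL' fun l hl => h l (.inr hl), hβ hM fun l hl => h l (.inl hl)⟩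

theorem UpDown.of_and_dnf {φ γ ψ : Formula}
    (h : ∀ L ∈ φ.dnf, UpDown (.and γ (litConj L)) ψ) : UpDown (.and γ φ) ψ := by
  have hS := hasLinear_upRules
  induction φ generalizing γ with
  | tt => exact h [] (by simp [Formula.dnf])
  | ff => exact .of_up_ff (up_and_right _ _) _
  | atom n b =>
    exact (h [(n, b)] (by simp [Formula.dnf])).up ((hS.derives (.eqAndUnitAdd _) rfl).andR _)
  | or α β hα hβ =>
    refine .up (up_distrib _ _ _) (.or_elim (hα fun L hL => h L ?_) (hβ fun L hL => h L ?_)) <;>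
      simp [Formula.dnf, hL]
  | and α β hα hβ =>
    refine .up (hS.derives (.eqAndAssocR _ _ _) rfl) (hβ fun M hM => ?_)
    have hswap : Derives upRules (.and (.and γ α) (litConj M)) (.and (.and γ (litConj M)) α) :=
      calc
        Derives upRules (.and (.and γ α) (litConj M)) (.and γ (.and α (litConj M))) :=
          hS.derives (.eqAndAssocL _ _ _) rfl
        Derives upRules _ (.and γ (.and (litConj M) α)) := (hS.derives (.eqAndComm _ _) rfl).andR _
        Derives upRules _ (.and (.and γ (litConj M)) α) := hS.derives (.eqAndAssocR _ _ _) rfl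
    refine .up hswap (hα fun L hL => ?_)
    refine .up (.trans (hS.derives (.eqAndAssocL _ _ _) rfl)
      ((hS.litConj_append M L).andR _)) (h _ ?_)
    simp only [Formula.dnf, List.mem_flatMap, List.mem_map]
    exact ⟨M, hM, L, hL, rfl⟩

theorem UpDown.of_dnf {φ ψ : Formula} (h : ∀ L ∈ φ.dnf, UpDown (litConj L) ψ) :
    UpDown φ ψ := by
  have hS := hasLinear_upRules
  refine .up (.trans (hS.derives (.eqAndUnitAdd _) rfl) (hS.derives (.eqAndComm _ _) rfl))
    (.of_and_dnf (γ := .tt) fun L hL => .up ?_ (h L hL))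
  exact .trans (hS.derives (.eqAndComm _ _) rfl) (hS.derives (.eqAndUnitDel _) rfl)

theorem exists_compl_of_unsat {L : List (ℕ × Bool)}
    (h : ∀ v : ℕ → Bool, ∃ l ∈ L, v l.1 ≠ l.2) : ∃ n b, (n, b) ∈ L ∧ (n, !b) ∈ L := by
  obtain ⟨⟨n, b⟩, hl, hne⟩ := h fun n => decide ((n, true) ∈ L)
  refine ⟨n, b, hl, ?_⟩
  cases b <;> simp_all

theorem UpDown.of_entails {φ ψ : Formula} (h : ∀ v, φ.Holds v → ψ.Holds v) : UpDown φ ψ := by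
  refine .of_dnf fun L hL => ?_
  rw [← ψ.neg_neg, ← (litConj L).neg_neg]
  refine .neg (.of_dnf fun M hM => ?_)
  obtain ⟨n, b, h1, h2⟩ : ∃ n b, (n, b) ∈ L ++ M ∧ (n, !b) ∈ L ++ M := by
    refine exists_compl_of_unsat fun v => ?_
    by_contra! hv
    simp only [List.mem_append] at hv
    exact (Formula.holds_neg v ψ).1 (Formula.holds_of_mem_dnf hM fun l hl => hv l (.inr hl))
      (h v (Formula.holds_of_mem_dnf hL fun l hl => hv l (.inl hl)))
  have mixed : ∀ {n b}, (n, b) ∈ L → (n, !b) ∈ M → UpDown (litConj M) (litConj L).neg :=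
    fun {n b} hL hM => ⟨.atom n !b, up_litConj_mem hM, (up_litConj_mem hL).neg_up⟩
  rcases List.mem_append.1 h1 with h1 | h1 <;> rcases List.mem_append.1 h2 with h2 | h2
  · rw [← (litConj M).neg_neg]
    exact .neg (.of_up_ff (up_ff_of_compl (up_litConj_mem h1) (up_litConj_mem h2)) _)
  · exact mixed h1 h2
  · exact mixed h2 (by simpa using h1)
  · exact .of_up_ff (up_ff_of_compl (up_litConj_mem h1) (up_litConj_mem h2)) _

/-! ### Postponing weakening -/

/-- `Weak φ ψ`: `ψ` is obtained from `φ` by replacing some units `f` by atoms. -/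
inductive Weak : Formula → Formula → Prop
  | tt : Weak .tt .tt
  | ff : Weak .ff .ff
  | atom (n : ℕ) (b : Bool) : Weak (.atom n b) (.atom n b)
  | wk (n : ℕ) (b : Bool) : Weak .ff (.atom n b)
  | or {α α' β β' : Formula} : Weak α α' → Weak β β' → Weak (.or α β) (.or α' β')
  | and {α α' β β' : Formula} : Weak α α' → Weak β β' → Weak (.and α β) (.and α' β')

theorem Weak.refl (φ : Formula) : Weak φ φ := by
  induction φ with
  | tt => exact .tt
  | ff => exact .ff
  | atom n b => exact .atom n b
  | or _ _ h h' => exact .or h h'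
  | and _ _ h h' => exact .and h h'

theorem Weak.derives {φ ψ : Formula} (h : Weak φ ψ) : Derives {.awDown} φ ψ := by
  induction h with
  | wk n b => exact .of_rule rfl (.awDown n b)
  | or _ _ h h' => exact h.or h'
  | and _ _ h h' => exact h.and h'
  | _ => exact .refl

theorem Weak.postpone_rule {φ' φ ψ : Formula} {r : RuleName} (hw : Weak φ' φ)
    (h : RuleInstance r φ ψ) (hr : r ∈ downRules) :
    ∃ ψ', Derives downCore φ' ψ' ∧ Weak ψ' ψ := by
  have hS := hasLinear_downCore
  cases h
  case aiUp => simp [downRules] at hr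
  case awUp => simp [downRules] at hr
  case aiDown n b =>
    exact ⟨_, .of_rule (r := .aiDown) (by simp [downCore]) (by cases hw; exact .aiDown n b),
      .refl _⟩
  case awDown n b => cases hw; exact ⟨_, .refl, .wk n b⟩
  case acDown n b =>
    obtain _ | _ | _ | _ | ⟨h1, h2⟩ := hw
    cases h1 <;> cases h2
    · exact ⟨_, .of_rule (r := .acDown) (by simp [downCore]) (.acDown n b), .refl _⟩
    · exact ⟨_, hS.derives (.eqOrUnitDel _) rfl, .atom n b⟩
    · exact ⟨_, .trans (hS.derives (.eqOrComm _ _) rfl) (hS.derives (.eqOrUnitDel _) rfl),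
        .atom n b⟩
    · exact ⟨_, hS.derives (.eqOrUnitDel _) rfl, .wk n b⟩
  case acUp n b =>
    cases hw
    · exact ⟨_, .of_rule (r := .acUp) (by simp [downCore]) (.acUp n b), .refl _⟩
    · exact ⟨_, hS.derives .eqFFAdd rfl, .and (.wk n b) (.wk n b)⟩
  case s =>
    obtain _ | _ | _ | _ | _ | ⟨h1, _ | _ | _ | _ | ⟨h2, h3⟩⟩ := hw
    exact ⟨_, hS.derives (.s _ _ _) rfl, .or (.and h1 h2) h3⟩
  case m =>
    obtain _ | _ | _ | _ | ⟨_ | _ | _ | _ | _ | ⟨h1, h2⟩, _ | _ | _ | _ | _ | ⟨h3, h4⟩⟩ := hw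
    exact ⟨_, hS.derives (.m _ _ _ _) rfl, .and (.or h1 h3) (.or h2 h4)⟩
  case eqOrComm =>
    obtain _ | _ | _ | _ | ⟨h1, h2⟩ := hw
    exact ⟨_, hS.derives (.eqOrComm _ _) rfl, .or h2 h1⟩
  case eqAndComm =>
    obtain _ | _ | _ | _ | _ | ⟨h1, h2⟩ := hw
    exact ⟨_, hS.derives (.eqAndComm _ _) rfl, .and h2 h1⟩
  case eqOrAssocL =>
    obtain _ | _ | _ | _ | ⟨_ | _ | _ | _ | ⟨h1, h2⟩, h3⟩ := hw
    exact ⟨_, hS.derives (.eqOrAssocL _ _ _) rfl, .or h1 (.or h2 h3)⟩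
  case eqOrAssocR =>
    obtain _ | _ | _ | _ | ⟨h1, _ | _ | _ | _ | ⟨h2, h3⟩⟩ := hw
    exact ⟨_, hS.derives (.eqOrAssocR _ _ _) rfl, .or (.or h1 h2) h3⟩
  case eqAndAssocL =>
    obtain _ | _ | _ | _ | _ | ⟨_ | _ | _ | _ | _ | ⟨h1, h2⟩, h3⟩ := hw
    exact ⟨_, hS.derives (.eqAndAssocL _ _ _) rfl, .and h1 (.and h2 h3)⟩
  case eqAndAssocR =>
    obtain _ | _ | _ | _ | _ | ⟨h1, _ | _ | _ | _ | _ | ⟨h2, h3⟩⟩ := hw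
    exact ⟨_, hS.derives (.eqAndAssocR _ _ _) rfl, .and (.and h1 h2) h3⟩
  case eqOrUnitDel =>
    obtain _ | _ | _ | _ | ⟨h1, _ | _⟩ := hw
    exact ⟨_, hS.derives (.eqOrUnitDel _) rfl, h1⟩
  case eqOrUnitAdd => exact ⟨_, hS.derives (.eqOrUnitAdd _) rfl, .or hw .ff⟩
  case eqAndUnitDel =>
    obtain _ | _ | _ | _ | _ | ⟨h1, _ | _⟩ := hw
    exact ⟨_, hS.derives (.eqAndUnitDel _) rfl, h1⟩
  case eqAndUnitAdd => exact ⟨_, hS.derives (.eqAndUnitAdd _) rfl, .and hw .tt⟩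
  case eqTTDel =>
    obtain _ | _ | _ | _ | ⟨_ | _, _ | _⟩ := hw
    exact ⟨_, hS.derives .eqTTDel rfl, .tt⟩
  case eqTTAdd => cases hw; exact ⟨_, hS.derives .eqTTAdd rfl, .refl _⟩
  case eqFFDel =>
    obtain _ | _ | _ | _ | _ | ⟨_ | _, _ | _⟩ := hw
    exact ⟨_, hS.derives .eqFFDel rfl, .ff⟩
  case eqFFAdd => cases hw; exact ⟨_, hS.derives .eqFFAdd rfl, .refl _⟩

theorem Weak.postpone {φ' φ ψ : Formula} {r : RuleName} {q : List Bool} (hw : Weak φ' φ)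
    (h : CStep r q φ ψ) (hr : r ∈ downRules) :
    ∃ ψ', Derives downCore φ' ψ' ∧ Weak ψ' ψ := by
  induction h generalizing φ' with
  | root h => exact hw.postpone_rule h hr
  | orL β _ ih =>
    obtain _ | _ | _ | _ | ⟨h1, h2⟩ := hw
    obtain ⟨ψ', h, h'⟩ := ih h1
    exact ⟨_, h.orL _, .or h' h2⟩
  | orR α _ ih =>
    obtain _ | _ | _ | _ | ⟨h1, h2⟩ := hw
    obtain ⟨ψ', h, h'⟩ := ih h2
    exact ⟨_, h.orR _, .or h1 h'⟩
  | andL β _ ih =>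
    obtain _ | _ | _ | _ | _ | ⟨h1, h2⟩ := hw
    obtain ⟨ψ', h, h'⟩ := ih h1
    exact ⟨_, h.andL _, .and h' h2⟩
  | andR α _ ih =>
    obtain _ | _ | _ | _ | _ | ⟨h1, h2⟩ := hw
    obtain ⟨ψ', h, h'⟩ := ih h2
    exact ⟨_, h.andR _, .and h1 h'⟩

theorem Derives.postpone_weakening {θ ψ : Formula} (h : Derives downRules θ ψ) :
    ∃ ψ', Derives downCore θ ψ' ∧ Derives {.awDown} ψ' ψ := by
  suffices ∃ ψ', Derives downCore θ ψ' ∧ Weak ψ' ψ from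
    let ⟨ψ', h, h'⟩ := this
    ⟨ψ', h, h'.derives⟩
  induction h with
  | refl => exact ⟨θ, .refl, .refl θ⟩
  | tail _ h ih =>
    obtain ⟨ψ', h1, h2⟩ := ih
    obtain ⟨r, hr, q, h⟩ := h
    obtain ⟨χ, h3, h4⟩ := h2.postpone h.cstep hr
    exact ⟨χ, h1.trans h3, h4⟩

theorem Derives.advance_coweakening {φ θ : Formula} (h : Derives upRules φ θ) :
    ∃ φ', Derives {.awUp} φ φ' ∧ Derives upCore φ' θ := by
  obtain ⟨χ, h1, h2⟩ := h.neg_up.postpone_weakening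
  refine ⟨χ.neg, ?_, ?_⟩
  · simpa using h2.neg (T := {.awUp}) (by simp [RuleName.dual]) (by simp)
  · simpa using h1.neg (T := upCore)
      (by intro r hr; cases r <;> simp_all [upCore, downCore, RuleName.dual])
      fun _ => hasLinear_upCore

/-! ### Assembling a phase-ordered derivation -/

/-- The steps `l` lead from `φ` to `ψ`. -/
def StepChain : Formula → List (RuleName × List Bool × Formula) → Formula → Prop
  | φ, [], ψ => φ = ψ
  | φ, t :: l, ψ => StepAt t.1 t.2.1 φ t.2.2 ∧ StepChain t.2.2 l ψ

theorem StepChain.append {φ θ ψ : Formula} {l l' : List (RuleName × List Bool × Formula)}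
    (h : StepChain φ l θ) (h' : StepChain θ l' ψ) : StepChain φ (l ++ l') ψ := by
  induction l generalizing φ with
  | nil => cases h; exact h'
  | cons t l ih => exact ⟨h.1, ih h.2⟩

theorem Derives.exists_chain {S : Set RuleName} {φ ψ : Formula} (h : Derives S φ ψ) :
    ∃ l, StepChain φ l ψ ∧ ∀ t ∈ l, t.1 ∈ S := by
  induction h with
  | refl => exact ⟨[], rfl, by simp⟩
  | @tail _ χ _ h ih =>
    obtain ⟨l, h1, h2⟩ := ih
    obtain ⟨r, hr, q, h⟩ := h
    refine ⟨l ++ [(r, q, χ)], h1.append ⟨h, rfl⟩, fun t ht => ?_⟩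
    rcases List.mem_append.1 ht with ht | ht
    · exact h2 t ht
    · rwa [List.mem_singleton.1 ht]

theorem StepChain.wf {φ ψ : Formula} {l : List (RuleName × List Bool × Formula)}
    (h : StepChain φ l ψ) : Deriv.WF ⟨φ, l⟩ ∧ Deriv.concl ⟨φ, l⟩ = ψ := by
  induction l generalizing φ with
  | nil => exact ⟨by intro i hi; simp at hi, h⟩
  | cons t l ih =>
    obtain ⟨h1, h2⟩ := ih h.2
    have hf : ∀ j ≤ l.length, Deriv.fml ⟨φ, t :: l⟩ (j + 1) = Deriv.fml ⟨t.2.2, l⟩ j := by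
      intro j hj
      simp only [Deriv.fml, List.map_cons, List.getD_cons_succ]
      rw [List.getD_eq_getElem _ _ (by simp; omega), List.getD_eq_getElem _ _ (by simp; omega)]
    refine ⟨?_, (hf _ le_rfl).trans h2⟩
    rintro (_ | i) hi
    · exact h.1
    · have hi' : i < l.length := by simpa using hi
      rw [hf _ hi'.le, hf _ hi']
      exact h1 i hi'

/-- Whether rule `r` may occur above rule `r'` in a phase-ordered derivation. -/
def PhaseOrder (r r' : RuleName) : Prop :=
  (r = .awDown → r' = .awDown) ∧ (r' = .awUp → r = .awUp) ∧ ¬ (r = .aiDown ∧ r' = .aiUp)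

theorem PhaseOrder.of_ne {r r' : RuleName} (h : r ≠ .awDown) (h' : r' ≠ .awUp)
    (hi : r ≠ .aiDown ∨ r' ≠ .aiUp) : PhaseOrder r r' :=
  ⟨fun e => absurd e h, fun e => absurd e h', fun e => hi.elim (· e.1) (· e.2)⟩

theorem UpDown.exists_phaseOrdered {φ ψ : Formula} (h : UpDown φ ψ) :
    ∃ Ψ : Deriv, Ψ.WF ∧ Ψ.prem = φ ∧ Ψ.concl = ψ ∧
      Ψ.steps.Pairwise fun t t' => PhaseOrder t.1 t'.1 := by
  obtain ⟨θ, hup, hdown⟩ := h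
  obtain ⟨φ', h1, h2⟩ := hup.advance_coweakening
  obtain ⟨ψ', h3, h4⟩ := hdown.postpone_weakening
  obtain ⟨l1, c1, s1⟩ := h1.exists_chain
  obtain ⟨l2, c2, s2⟩ := h2.exists_chain
  obtain ⟨l3, c3, s3⟩ := h3.exists_chain
  obtain ⟨l4, c4, s4⟩ := h4.exists_chain
  obtain ⟨wf, hc⟩ := (c1.append (c2.append (c3.append c4))).wf
  refine ⟨_, wf, rfl, hc, ?_⟩
  have key : ∀ {l : List (RuleName × List Bool × Formula)} {S : Set RuleName},
      (∀ t ∈ l, t.1 ∈ S) → (∀ r ∈ S, ∀ r' ∈ S, PhaseOrder r r') →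
      l.Pairwise fun t t' => PhaseOrder t.1 t'.1 :=
    fun hl hS => List.pairwise_of_forall_mem_list fun _ ht _ ht' => hS _ (hl _ ht) _ (hl _ ht')
  simp only [List.pairwise_append, List.mem_append]
  refine ⟨key s1 ?_, ⟨key s2 ?_, ⟨key s3 ?_, key s4 ?_, ?_⟩, ?_⟩, ?_⟩
  · simp [PhaseOrder]
  · exact fun r hr r' hr' => .of_ne hr.2.1 hr'.2.2 (.inl hr.1)
  · exact fun r hr r' hr' => .of_ne hr.2.2 hr'.2.1 (.inr hr'.1)
  · simp [PhaseOrder]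
  · intro t ht t' ht'
    rw [Set.mem_singleton_iff.1 (s4 t' ht')]
    exact .of_ne (s3 t ht).2.2 nofun (.inr nofun)
  · rintro t ht t' (ht' | ht')
    · exact .of_ne (s2 t ht).2.1 (s3 t' ht').2.1 (.inl (s2 t ht).1)
    · rw [Set.mem_singleton_iff.1 (s4 t' ht')]
      exact .of_ne (s2 t ht).2.1 nofun (.inr nofun)
  · intro t ht t' ht'
    rw [Set.mem_singleton_iff.1 (s1 t ht)]
    simp [PhaseOrder]

end AF

namespace AF

/-! ### Tracing atom occurrences through a rule -/

/-- Atom occurrences of a formula. -/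
def Formula.occs : Formula → Finset (List Bool)
  | .tt | .ff => ∅
  | .atom _ _ => {[]}
  | .or α β | .and α β => α.occs.image (List.cons false) ∪ β.occs.image (List.cons true)

theorem Formula.mem_occs {φ : Formula} {p : List Bool} : p ∈ φ.occs ↔ φ.IsOcc p := by
  induction φ generalizing p with
  | tt | ff | atom => cases p <;> simp [occs, IsOcc, sub]
  | or α β hα hβ | and α β hα hβ =>
    rcases p with _ | ⟨_ | _, p⟩ <;> simp [occs, IsOcc, sub, hα, hβ]

/-- The vertex label of a structural rule (a dummy value for the other rules). -/
def RuleName.label : RuleName → FlowLabel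
  | .aiUp => .aiUp
  | .awDown => .awDown
  | .awUp => .awUp
  | .acDown => .acDown
  | .acUp => .acUp
  | _ => .aiDown

/-- Position in the redex from which a position in the contractum is traced. -/
def RuleName.back : RuleName → List Bool → Option (List Bool)
  | .s, false :: false :: x => some (false :: x)
  | .s, false :: true :: x => some (true :: false :: x)
  | .s, true :: x => some (true :: true :: x)
  | .m, a :: b :: x => some (b :: a :: x)
  | .eqOrComm, b :: x => some ((!b) :: x)
  | .eqAndComm, b :: x => some ((!b) :: x)
  | .eqOrAssocL, false :: x => some (false :: false :: x)
  | .eqOrAssocL, true :: false :: x => some (false :: true :: x)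
  | .eqOrAssocL, true :: true :: x => some (true :: x)
  | .eqAndAssocL, false :: x => some (false :: false :: x)
  | .eqAndAssocL, true :: false :: x => some (false :: true :: x)
  | .eqAndAssocL, true :: true :: x => some (true :: x)
  | .eqOrAssocR, false :: false :: x => some (false :: x)
  | .eqOrAssocR, false :: true :: x => some (true :: false :: x)
  | .eqOrAssocR, true :: x => some (true :: true :: x)
  | .eqAndAssocR, false :: false :: x => some (false :: x)
  | .eqAndAssocR, false :: true :: x => some (true :: false :: x)
  | .eqAndAssocR, true :: x => some (true :: true :: x)
  | .eqOrUnitDel, x => some (false :: x)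
  | .eqOrUnitAdd, false :: x => some x
  | .eqAndUnitDel, x => some (false :: x)
  | .eqAndUnitAdd, false :: x => some x
  | _, _ => none

theorem RuleName.back_eq_none {r : RuleName} (hr : r.isStructural = true) (x : List Bool) :
    r.back x = none := by
  cases r <;> simp_all [isStructural, back]

theorem RuleName.back_injective {r : RuleName} {x y z : List Bool} (hx : r.back x = some z)
    (hy : r.back y = some z) : x = y := by
  cases r <;> rcases x with _ | ⟨_ | _, _ | ⟨_ | _, x⟩⟩ <;>
    rcases y with _ | ⟨_ | _, _ | ⟨_ | _, y⟩⟩ <;> simp [back] at hx hy ⊢ <;> grind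

theorem RuleInstance.sub_of_back {r : RuleName} {γ δ : Formula} (h : RuleInstance r γ δ)
    {x y : List Bool} (hxy : r.back x = some y) {n : ℕ} {b : Bool}
    (hx : δ.sub x = some (.atom n b)) : γ.sub y = some (.atom n b) := by
  cases h <;> rcases x with _ | ⟨_ | _, _ | ⟨_ | _, x⟩⟩ <;>
    simp [RuleName.back] at hxy <;> subst hxy <;> simp_all [Formula.sub]

theorem RuleInstance.back_ne_none {r : RuleName} {γ δ : Formula} (h : RuleInstance r γ δ)
    (hr : r.isStructural = false) {x : List Bool} (hx : δ.IsOcc x) : r.back x ≠ none := by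
  obtain ⟨n, b, hx⟩ := hx
  cases h <;> rcases x with _ | ⟨_ | _, _ | ⟨_ | _, x⟩⟩ <;>
    simp_all [RuleName.back, Formula.sub, RuleName.isStructural]

/-- Position in the premiss of a step from which a position in its conclusion is traced. -/
def RuleName.trace (r : RuleName) : List Bool → List Bool → Option (List Bool)
  | [], p => r.back p
  | _ :: _, [] => some []
  | b :: q, c :: p => if c = b then (r.trace q p).map (List.cons c) else some (c :: p)

theorem RuleName.trace_append (r : RuleName) (q x : List Bool) :
    r.trace q (q ++ x) = (r.back x).map (q ++ ·) := by
  induction q with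
  | nil => simp [trace]
  | cons b q ih => simp [trace, ih, Function.comp_def]

theorem RuleName.trace_eq_self (r : RuleName) {q p : List Bool} (h : ¬ q <+: p) :
    r.trace q p = some p := by
  induction q generalizing p with
  | nil => simp at h
  | cons b q ih =>
    cases p with
    | nil => rfl
    | cons c p =>
      simp only [trace]
      split
      · subst c
        rw [ih fun h' => h (by simpa using h')]
        rfl
      · rfl

theorem RuleName.trace_structural {r : RuleName} (hr : r.isStructural = true) {q p p' : List Bool}
    (h : r.trace q p = some p') : ¬ q <+: p ∧ p' = p := by
  by_cases hq : q <+: p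
  · obtain ⟨x, rfl⟩ := hq
    simp [trace_append, back_eq_none hr] at h
  · rw [trace_eq_self r hq, Option.some.injEq] at h
    exact ⟨hq, h.symm⟩

theorem RuleName.trace_injective {r : RuleName} {q p₁ p₂ p : List Bool}
    (h₁ : r.trace q p₁ = some p) (h₂ : r.trace q p₂ = some p) : p₁ = p₂ := by
  induction q generalizing p₁ p₂ p with
  | nil => exact back_injective h₁ h₂
  | cons b q ih =>
    cases p₁ <;> cases p₂ <;> simp only [trace] at h₁ h₂ <;> grind [Option.map_eq_some_iff]

theorem CStep.sub_of_trace {r : RuleName} {q : List Bool} {φ ψ : Formula} (h : CStep r q φ ψ)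
    {p p' : List Bool} (hp : r.trace q p = some p') {n : ℕ} {b : Bool}
    (hx : ψ.sub p = some (.atom n b)) : φ.sub p' = some (.atom n b) := by
  induction h generalizing p p' with
  | root h => exact h.sub_of_back hp hx
  | _ _ _ ih =>
    rcases p with _ | ⟨_ | _, p⟩
    · simp [Formula.sub] at hx
    all_goals
      simp [RuleName.trace] at hp
      grind [Formula.sub]

/-- The redex and the contractum of a step. -/
theorem CStep.exists_rule {r : RuleName} {q : List Bool} {φ ψ : Formula} (h : CStep r q φ ψ) :
    ∃ γ δ, RuleInstance r γ δ ∧ (∀ x, φ.sub (q ++ x) = γ.sub x) ∧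
      ∀ x, ψ.sub (q ++ x) = δ.sub x := by
  induction h with
  | root h => exact ⟨_, _, h, fun _ => rfl, fun _ => rfl⟩
  | _ _ _ ih => simpa [Formula.sub] using ih

theorem CStep.trace_ne_none {r : RuleName} {q : List Bool} {φ ψ : Formula} (h : CStep r q φ ψ)
    (hr : r.isStructural = false) {p : List Bool} (hp : ψ.IsOcc p) : r.trace q p ≠ none := by
  by_cases hq : q <+: p
  · obtain ⟨x, rfl⟩ := hq
    obtain ⟨γ, δ, hrule, -, hδ⟩ := h.exists_rule
    have := hrule.back_ne_none hr (x := x) (by simpa [Formula.IsOcc, hδ] using hp)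
    simpa [RuleName.trace_append] using this
  · simp [r.trace_eq_self hq]

/-! ### Edges of the flow of a derivation -/

namespace Deriv

variable {Φ : Deriv}

/-- The edge of an atom occurrence: its formula index and position of birth. -/
def edge (Φ : Deriv) : ℕ → List Bool → ℕ
  | 0, p => Nat.pair 0 (Encodable.encode p)
  | i + 1, p =>
    match (Φ.stepAt i).1.trace (Φ.stepAt i).2.1 p with
    | some p' => Φ.edge i p'
    | none => Nat.pair (i + 1) (Encodable.encode p)

/-- The index of the formula in which an edge is born. -/
def birth (e : ℕ) : ℕ := e.unpair.1

theorem edge_of_trace {i : ℕ} {p p' : List Bool}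
    (h : (Φ.stepAt i).1.trace (Φ.stepAt i).2.1 p = some p') : Φ.edge (i + 1) p = Φ.edge i p' := by
  simp [edge, h]

theorem edge_of_trace_none {i : ℕ} {p : List Bool}
    (h : (Φ.stepAt i).1.trace (Φ.stepAt i).2.1 p = none) :
    Φ.edge (i + 1) p = Nat.pair (i + 1) (Encodable.encode p) := by
  simp [edge, h]

theorem birth_edge_le (Φ : Deriv) (i : ℕ) (p : List Bool) : birth (Φ.edge i p) ≤ i := by
  induction i generalizing p with
  | zero => simp [edge, birth]
  | succ i ih =>
    rcases h : (Φ.stepAt i).1.trace (Φ.stepAt i).2.1 p with _ | p'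
    · simp [edge_of_trace_none h, birth]
    · rw [edge_of_trace h]
      exact (ih p').trans (Nat.le_succ i)

theorem WF.cstep (hΦ : Φ.WF) {i : ℕ} (hi : i < Φ.steps.length) :
    CStep (Φ.stepAt i).1 (Φ.stepAt i).2.1 (Φ.fml i) (Φ.fml (i + 1)) :=
  (hΦ i hi).cstep

theorem WF.isOcc_of_trace (hΦ : Φ.WF) {i : ℕ} (hi : i < Φ.steps.length) {p p' : List Bool}
    (h : (Φ.stepAt i).1.trace (Φ.stepAt i).2.1 p = some p') (hp : (Φ.fml (i + 1)).IsOcc p) :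
    (Φ.fml i).IsOcc p' :=
  let ⟨n, b, hp⟩ := hp
  ⟨n, b, (hΦ.cstep hi).sub_of_trace h hp⟩

theorem WF.edge_injective (hΦ : Φ.WF) {i : ℕ} (hi : i ≤ Φ.steps.length) {p p' : List Bool}
    (hp : (Φ.fml i).IsOcc p) (hp' : (Φ.fml i).IsOcc p') (h : Φ.edge i p = Φ.edge i p') :
    p = p' := by
  induction i generalizing p p' with
  | zero => simpa [edge] using h
  | succ i ih =>
    rcases ht : (Φ.stepAt i).1.trace (Φ.stepAt i).2.1 p with _ | x <;>
    rcases ht' : (Φ.stepAt i).1.trace (Φ.stepAt i).2.1 p' with _ | y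
    · simpa [edge_of_trace_none ht, edge_of_trace_none ht'] using h
    · have := birth_edge_le Φ i y
      rw [← edge_of_trace ht', ← h, edge_of_trace_none ht] at this
      simp [birth] at this
    · have := birth_edge_le Φ i x
      rw [← edge_of_trace ht, h, edge_of_trace_none ht'] at this
      simp [birth] at this
    · rw [edge_of_trace ht, edge_of_trace ht'] at h
      have := ih (by omega) (hΦ.isOcc_of_trace hi ht hp) (hΦ.isOcc_of_trace hi ht' hp') h
      subst this
      exact RuleName.trace_injective ht ht'

theorem WF.exists_birth (hΦ : Φ.WF) {i : ℕ} (hi : i ≤ Φ.steps.length) {p : List Bool} {n : ℕ}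
    {b : Bool} (hp : (Φ.fml i).sub p = some (.atom n b)) :
    ∃ j p₀, j ≤ i ∧ Φ.edge i p = Nat.pair j (Encodable.encode p₀) ∧
      (Φ.fml j).sub p₀ = some (.atom n b) ∧ Φ.edge j p₀ = Φ.edge i p ∧
      ∀ k, j = k + 1 → (Φ.stepAt k).1.trace (Φ.stepAt k).2.1 p₀ = none := by
  induction i generalizing p with
  | zero => exact ⟨0, p, le_rfl, rfl, hp, rfl, by simp⟩
  | succ i ih =>
    rcases ht : (Φ.stepAt i).1.trace (Φ.stepAt i).2.1 p with _ | x
    · refine ⟨i + 1, p, le_rfl, edge_of_trace_none ht, hp, rfl, ?_⟩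
      rintro k hk
      obtain rfl : i = k := by omega
      exact ht
    · obtain ⟨j, p₀, hj, h⟩ := ih (by omega) ((hΦ.cstep hi).sub_of_trace ht hp)
      rw [edge_of_trace ht]
      exact ⟨j, p₀, by omega, h⟩

/-- The occurrence at position `p` of the `i`-th formula is consumed by the `i`-th step. -/
def Consumed (Φ : Deriv) (i : ℕ) (p : List Bool) : Prop :=
  i < Φ.steps.length ∧ (Φ.stepAt i).1.isStructural = true ∧ (Φ.fml i).IsOcc p ∧
    (Φ.stepAt i).2.1 <+: p

theorem WF.exists_prev (hΦ : Φ.WF) {i : ℕ} (hi : i < Φ.steps.length) {p : List Bool}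
    (hp : (Φ.fml (i + 1)).IsOcc p) (hb : birth (Φ.edge (i + 1) p) ≤ i) :
    ∃ p', (Φ.stepAt i).1.trace (Φ.stepAt i).2.1 p = some p' ∧ (Φ.fml i).IsOcc p' ∧
      Φ.edge i p' = Φ.edge (i + 1) p := by
  rcases ht : (Φ.stepAt i).1.trace (Φ.stepAt i).2.1 p with _ | x
  · simp [edge_of_trace_none ht, birth] at hb
  · exact ⟨x, rfl, hΦ.isOcc_of_trace hi ht hp, (edge_of_trace ht).symm⟩

theorem WF.edge_ne_of_consumed (hΦ : Φ.WF) {i j : ℕ} {p p' : List Bool} (h : Φ.Consumed i p)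
    (hij : i < j) (hj : j ≤ Φ.steps.length) (hp' : (Φ.fml j).IsOcc p') :
    Φ.edge j p' ≠ Φ.edge i p := by
  intro he
  have hb := birth_edge_le Φ i p
  induction j, hij using Nat.le_induction generalizing p' with
  | base =>
    obtain ⟨x, ht, hx, hex⟩ := hΦ.exists_prev hj hp' (by rw [he]; exact hb)
    obtain rfl := hΦ.edge_injective (by omega) hx h.2.2.1 (hex.trans he)
    obtain ⟨h1, rfl⟩ := RuleName.trace_structural h.2.1 ht
    exact h1 h.2.2.2
  | succ j hij ih =>
    obtain ⟨x, -, hx, hex⟩ := hΦ.exists_prev hj hp' (by rw [he]; omega)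
    exact ih (by omega) hx (hex.trans he)

theorem WF.consumed_unique (hΦ : Φ.WF) {i j : ℕ} {p p' : List Bool} (h : Φ.Consumed i p)
    (h' : Φ.Consumed j p') (he : Φ.edge i p = Φ.edge j p') : i = j := by
  rcases lt_trichotomy i j with hij | hij | hij
  · exact absurd he.symm (hΦ.edge_ne_of_consumed h hij h'.1.le h'.2.2.1)
  · exact hij
  · exact absurd he (hΦ.edge_ne_of_consumed h' hij h.1.le h.2.2.1)

/-! ### The flow of a derivation -/

open Classical in
/-- The atomic flow of a derivation: vertices are the indices of structural steps. -/
noncomputable def flow (Φ : Deriv) : PreFlow where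
  V := (Finset.range Φ.steps.length).filter fun i => (Φ.stepAt i).1.isStructural = true
  E := (Finset.range Φ.nf).biUnion fun i => (Φ.fml i).occs.image (Φ.edge i)
  η i := (Φ.stepAt i).1.label
  up e := if birth e = 0 then none else some (birth e - 1)
  lo e := if h : ∃ i p, Φ.Consumed i p ∧ Φ.edge i p = e then some h.choose else none

theorem mem_flow_V {v : ℕ} :
    v ∈ Φ.flow.V ↔ v < Φ.steps.length ∧ (Φ.stepAt v).1.isStructural = true := by
  simp [flow]

theorem mem_flow_E {e : ℕ} :
    e ∈ Φ.flow.E ↔ ∃ i p, i < Φ.nf ∧ (Φ.fml i).IsOcc p ∧ Φ.edge i p = e := by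
  simp [flow, Formula.mem_occs]

theorem flow_up_eq_some {e v : ℕ} : Φ.flow.up e = some v ↔ birth e = v + 1 := by
  simp only [flow]
  split <;> simp <;> omega

theorem WF.flow_lo_eq_some (hΦ : Φ.WF) {e v : ℕ} :
    Φ.flow.lo e = some v ↔ ∃ p, Φ.Consumed v p ∧ Φ.edge v p = e := by
  simp only [flow]
  constructor
  · intro h
    split at h
    · rename_i hex
      cases h
      exact hex.choose_spec
    · cases h
  · rintro ⟨p, hc, he⟩
    have hex : ∃ i p, Φ.Consumed i p ∧ Φ.edge i p = e := ⟨v, p, hc, he⟩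
    rw [dif_pos hex]
    obtain ⟨p', hc', he'⟩ := hex.choose_spec
    rw [hΦ.consumed_unique hc' hc (he'.trans he.symm)]

theorem WF.flow_up_lt_lo (hΦ : Φ.WF) {e v w : ℕ} (hv : Φ.flow.up e = some v)
    (hw : Φ.flow.lo e = some w) : v < w := by
  obtain ⟨p, -, rfl⟩ := hΦ.flow_lo_eq_some.1 hw
  have := birth_edge_le Φ w p
  rw [flow_up_eq_some.1 hv] at this
  omega

theorem WF.flow_born (hΦ : Φ.WF) {e v : ℕ} (he : e ∈ Φ.flow.E) (hv : Φ.flow.up e = some v) :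
    v ∈ Φ.flow.V ∧ ∃ p, (Φ.fml (v + 1)).IsOcc p ∧ (Φ.stepAt v).2.1 <+: p ∧
      Φ.edge (v + 1) p = e := by
  obtain ⟨i, p, hi, ⟨n, b, hp⟩, rfl⟩ := mem_flow_E.1 he
  have hi' : i ≤ Φ.steps.length := Nat.lt_succ_iff.1 hi
  obtain ⟨j, p₀, hj, h1, h2, h3, h4⟩ := hΦ.exists_birth hi' hp
  have hjv : j = v + 1 := by
    have := flow_up_eq_some.1 hv
    rwa [h1, birth, Nat.unpair_pair] at this
  subst hjv
  have h5 := h4 v rfl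
  have hvl : v < Φ.steps.length := by omega
  refine ⟨mem_flow_V.2 ⟨hvl, ?_⟩, p₀, ⟨n, b, h2⟩, ?_, h3⟩
  · by_contra hs
    exact (hΦ.cstep hvl).trace_ne_none (by simpa using hs) ⟨n, b, h2⟩ h5
  · by_contra hq
    simp [RuleName.trace_eq_self _ hq] at h5

theorem flow_up_edge {v : ℕ} (hs : (Φ.stepAt v).1.isStructural = true) (x : List Bool) :
    Φ.flow.up (Φ.edge (v + 1) ((Φ.stepAt v).2.1 ++ x)) = some v := by
  rw [flow_up_eq_some, edge_of_trace_none, birth, Nat.unpair_pair]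
  simp [RuleName.trace_append, RuleName.back_eq_none hs]

/-- Redex and contractum of the `i`-th step. -/
theorem WF.exists_rule (hΦ : Φ.WF) {i : ℕ} (hi : i < Φ.steps.length) :
    ∃ γ δ, RuleInstance (Φ.stepAt i).1 γ δ ∧
      (∀ x, (Φ.fml i).sub ((Φ.stepAt i).2.1 ++ x) = γ.sub x) ∧
      ∀ x, (Φ.fml (i + 1)).sub ((Φ.stepAt i).2.1 ++ x) = δ.sub x :=
  (hΦ.cstep hi).exists_rule

theorem WF.flow_Ledges (hΦ : Φ.WF) {v : ℕ} (hv : v ∈ Φ.flow.V) {δ : Formula}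
    (hδ : ∀ x, (Φ.fml (v + 1)).sub ((Φ.stepAt v).2.1 ++ x) = δ.sub x) :
    Φ.flow.Ledges v = δ.occs.image fun x => Φ.edge (v + 1) ((Φ.stepAt v).2.1 ++ x) := by
  obtain ⟨hvl, hs⟩ := mem_flow_V.1 hv
  ext e
  simp only [PreFlow.Ledges, Finset.mem_filter, Finset.mem_image, Formula.mem_occs]
  constructor
  · rintro ⟨he, hup⟩
    obtain ⟨-, p, hp, ⟨x, rfl⟩, rfl⟩ := hΦ.flow_born he hup
    exact ⟨x, by simpa [Formula.IsOcc, hδ] using hp, rfl⟩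
  · rintro ⟨x, hx, rfl⟩
    refine ⟨mem_flow_E.2 ⟨v + 1, _, Nat.succ_lt_succ hvl, ?_, rfl⟩, flow_up_edge hs x⟩
    simpa [Formula.IsOcc, hδ] using hx

theorem WF.flow_Uedges (hΦ : Φ.WF) {v : ℕ} (hv : v ∈ Φ.flow.V) {γ : Formula}
    (hγ : ∀ x, (Φ.fml v).sub ((Φ.stepAt v).2.1 ++ x) = γ.sub x) :
    Φ.flow.Uedges v = γ.occs.image fun x => Φ.edge v ((Φ.stepAt v).2.1 ++ x) := by
  obtain ⟨hvl, hs⟩ := mem_flow_V.1 hv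
  ext e
  simp only [PreFlow.Uedges, Finset.mem_filter, Finset.mem_image, Formula.mem_occs,
    hΦ.flow_lo_eq_some]
  constructor
  · rintro ⟨-, p, ⟨-, -, hp, x, rfl⟩, rfl⟩
    exact ⟨x, by simpa [Formula.IsOcc, hγ] using hp, rfl⟩
  · rintro ⟨x, hx, rfl⟩
    have hocc : (Φ.fml v).IsOcc ((Φ.stepAt v).2.1 ++ x) := by
      simpa [Formula.IsOcc, hγ] using hx
    exact ⟨mem_flow_E.2 ⟨v, _, hvl.trans (Nat.lt_succ_self _), hocc, rfl⟩,
      _, ⟨hvl, hs, hocc, List.prefix_append _ _⟩, rfl⟩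

theorem WF.card_image_edge (hΦ : Φ.WF) {i : ℕ} (hi : i ≤ Φ.steps.length) {q : List Bool}
    {γ : Formula} (hγ : ∀ x, (Φ.fml i).sub (q ++ x) = γ.sub x) :
    (γ.occs.image fun x => Φ.edge i (q ++ x)).card = γ.occs.card := by
  refine Finset.card_image_of_injOn fun x hx y hy h => ?_
  have hx : γ.IsOcc x := Formula.mem_occs.1 hx
  have hy : γ.IsOcc y := Formula.mem_occs.1 hy
  exact List.append_cancel_left (hΦ.edge_injective hi (by simpa [Formula.IsOcc, hγ] using hx)
    (by simpa [Formula.IsOcc, hγ] using hy) h)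

theorem WF.flow_degOK (hΦ : Φ.WF) : Φ.flow.degOK := by
  intro v hv
  obtain ⟨hvl, hs⟩ := mem_flow_V.1 hv
  obtain ⟨γ, δ, hrule, hγ, hδ⟩ := hΦ.exists_rule hvl
  rw [hΦ.flow_Ledges hv hδ, hΦ.flow_Uedges hv hγ, hΦ.card_image_edge hvl hδ,
    hΦ.card_image_edge hvl.le hγ]
  change _ = (labDeg (Φ.stepAt v).1.label).1 ∧ _ = (labDeg (Φ.stepAt v).1.label).2
  generalize (Φ.stepAt v).1 = r at hrule hs
  cases hrule <;> simp [RuleName.isStructural] at hs <;>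
    exact ⟨rfl, rfl⟩

theorem WF.flow_endpointsOK (hΦ : Φ.WF) : Φ.flow.endpointsOK := by
  refine fun e he => ⟨fun v hv => (hΦ.flow_born he hv).1, fun v hv => ?_⟩
  obtain ⟨p, hc, -⟩ := hΦ.flow_lo_eq_some.1 hv
  exact mem_flow_V.2 ⟨hc.1, hc.2.1⟩

theorem WF.flow_acyclic (hΦ : Φ.WF) : Φ.flow.Acyclic := by
  rintro ⟨h, ε, -, hε⟩
  choose x hx using fun i => Option.isSome_iff_exists.1 (hε i).1
  obtain ⟨i, hi⟩ := Finite.exists_min x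
  have hlo : Φ.flow.lo (ε (i + 1)) = some (x i) := by rw [← (hε i).2, hx]
  exact absurd (hΦ.flow_up_lt_lo (hx (i + 1)) hlo) (hi _).not_gt

open Classical in
/-- The polarity of an edge: the sign of the atom at its birth. -/
noncomputable def polarity (Φ : Deriv) (e : ℕ) : Bool :=
  decide (∃ n, (Φ.fml (birth e)).sub ((Encodable.decode e.unpair.2).getD []) =
    some (.atom n true))

theorem WF.polarity_edge (hΦ : Φ.WF) {i : ℕ} (hi : i ≤ Φ.steps.length) {p : List Bool} {n : ℕ}
    {b : Bool} (hp : (Φ.fml i).sub p = some (.atom n b)) : Φ.polarity (Φ.edge i p) = b := by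
  obtain ⟨j, p₀, -, h1, h2, -⟩ := hΦ.exists_birth hi hp
  rw [polarity, h1, birth]
  cases b <;> simp [h2]

theorem WF.flow_polarityOK (hΦ : Φ.WF) : Φ.flow.PolarityOK Φ.polarity := by
  intro v hv
  obtain ⟨hvl, hs⟩ := mem_flow_V.1 hv
  obtain ⟨γ, δ, hrule, hγ, hδ⟩ := hΦ.exists_rule hvl
  have hpγ : ∀ x {n b}, γ.sub x = some (.atom n b) →
      Φ.polarity (Φ.edge v ((Φ.stepAt v).2.1 ++ x)) = b :=
    fun _ _ _ h => hΦ.polarity_edge hvl.le ((hγ _).trans h)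
  have hpδ : ∀ x {n b}, δ.sub x = some (.atom n b) →
      Φ.polarity (Φ.edge (v + 1) ((Φ.stepAt v).2.1 ++ x)) = b :=
    fun _ _ _ h => hΦ.polarity_edge hvl ((hδ _).trans h)
  rw [PreFlow.edges, hΦ.flow_Ledges hv hδ, hΦ.flow_Uedges hv hγ]
  change ((Φ.stepAt v).1.label = _ ∨ (Φ.stepAt v).1.label = _ → _) ∧
    ((Φ.stepAt v).1.label = _ ∨ (Φ.stepAt v).1.label = _ → _)
  generalize (Φ.stepAt v).1 = r at hrule hs
  generalize (Φ.stepAt v).2.1 = q at *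
  cases hrule <;> simp [RuleName.isStructural] at hs
  case aiDown => simp [RuleName.label, Formula.occs, hpδ [false] rfl, hpδ [true] rfl]
  case aiUp => simp [RuleName.label, Formula.occs, hpγ [false] rfl, hpγ [true] rfl]
  case acDown =>
    have := hpδ [] rfl
    simp_all [RuleName.label, Formula.occs, hpγ [false] rfl, hpγ [true] rfl]
  case acUp =>
    have := hpγ [] rfl
    simp_all [RuleName.label, Formula.occs, hpδ [false] rfl, hpδ [true] rfl]
  all_goals simp [RuleName.label]

theorem WF.flow_isFlow (hΦ : Φ.WF) : Φ.flow.IsFlow :=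
  ⟨hΦ.flow_degOK, hΦ.flow_endpointsOK, hΦ.flow_acyclic, _, hΦ.flow_polarityOK⟩

theorem WF.flow_stepCond (hΦ : Φ.WF) {i : ℕ} (hi : i < Φ.steps.length) :
    stepCond Φ.flow Φ.edge i i (Φ.stepAt i).1 (Φ.stepAt i).2.1 (Φ.fml i) (Φ.fml (i + 1)) := by
  refine ⟨fun p hp _ => edge_of_trace (RuleName.trace_eq_self _ hp), ?_⟩
  obtain ⟨γ, δ, hrule, hγ, hδ⟩ := hΦ.exists_rule hi
  have hup : (Φ.stepAt i).1.isStructural = true → ∀ x, Φ.flow.up (Φ.edge (i + 1)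
      ((Φ.stepAt i).2.1 ++ x)) = some i := flow_up_edge
  have hlo : (Φ.stepAt i).1.isStructural = true → ∀ x, γ.IsOcc x → Φ.flow.lo (Φ.edge i
      ((Φ.stepAt i).2.1 ++ x)) = some i := fun hs x hx =>
    hΦ.flow_lo_eq_some.2 ⟨_, ⟨hi, hs, by simpa [Formula.IsOcc, hγ] using hx,
      List.prefix_append _ _⟩, rfl⟩
  have hneγ : ∀ x y, γ.IsOcc x → γ.IsOcc y → x ≠ y →
      Φ.edge i ((Φ.stepAt i).2.1 ++ x) ≠ Φ.edge i ((Φ.stepAt i).2.1 ++ y) :=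
    fun x y hx hy hne he => hne (List.append_cancel_left (hΦ.edge_injective hi.le
      (by simpa [Formula.IsOcc, hγ] using hx) (by simpa [Formula.IsOcc, hγ] using hy) he))
  have hneδ : ∀ x y, δ.IsOcc x → δ.IsOcc y → x ≠ y →
      Φ.edge (i + 1) ((Φ.stepAt i).2.1 ++ x) ≠ Φ.edge (i + 1) ((Φ.stepAt i).2.1 ++ y) :=
    fun x y hx hy hne he => hne (List.append_cancel_left (hΦ.edge_injective hi
      (by simpa [Formula.IsOcc, hδ] using hx) (by simpa [Formula.IsOcc, hδ] using hy) he))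
  have hcorr : ∀ cs : List (List Bool × List Bool),
      (∀ c ∈ cs, ∀ x, (Φ.stepAt i).1.back (c.1 ++ x) = some (c.2 ++ x)) →
      corrCond Φ.edge i (Φ.stepAt i).2.1 (Φ.fml (i + 1)) cs := by
    intro cs hcs c hc x _
    rw [List.append_assoc, List.append_assoc]
    exact edge_of_trace (by rw [RuleName.trace_append, hcs c hc x]; rfl)
  have hη : Φ.flow.η i = (Φ.stepAt i).1.label := rfl
  generalize (Φ.stepAt i).1 = r at *
  generalize (Φ.stepAt i).2.1 = q at *
  cases hrule
  case aiDown => exact ⟨hη, hup rfl _, hup rfl _, hneδ _ _ ⟨_, _, rfl⟩ ⟨_, _, rfl⟩ (by simp)⟩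
  case aiUp =>
    exact ⟨hη, hlo rfl _ ⟨_, _, rfl⟩, hlo rfl _ ⟨_, _, rfl⟩,
      hneγ _ _ ⟨_, _, rfl⟩ ⟨_, _, rfl⟩ (by simp)⟩
  case awDown => exact ⟨hη, by simpa using hup rfl []⟩
  case awUp => exact ⟨hη, by simpa using hlo rfl [] ⟨_, _, rfl⟩⟩
  case acDown =>
    exact ⟨hη, hlo rfl _ ⟨_, _, rfl⟩, hlo rfl _ ⟨_, _, rfl⟩, by simpa using hup rfl [],
      hneγ _ _ ⟨_, _, rfl⟩ ⟨_, _, rfl⟩ (by simp)⟩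
  case acUp =>
    exact ⟨hη, by simpa using hlo rfl [] ⟨_, _, rfl⟩, hup rfl _, hup rfl _,
      hneδ _ _ ⟨_, _, rfl⟩ ⟨_, _, rfl⟩ (by simp)⟩
  all_goals first | trivial | exact hcorr _ (by simp [RuleName.back])

theorem WF.isAssocFlow (hΦ : Φ.WF) : IsAssocFlow Φ Φ.flow Φ.edge id := by
  refine ⟨hΦ, hΦ.flow_isFlow, fun i p hi hp => mem_flow_E.2 ⟨i, p, hi, hp, rfl⟩,
    fun e he => mem_flow_E.1 he,
    fun i p p' hi hp hp' h => hΦ.edge_injective (Nat.lt_succ_iff.1 hi) hp hp' h,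
    fun p _ => by simp [flow, edge, birth], fun p hp => ?_,
    fun i hi hs => mem_flow_V.2 ⟨hi, hs⟩,
    fun v hv => ⟨v, (mem_flow_V.1 hv).1, (mem_flow_V.1 hv).2, rfl⟩,
    fun i j _ _ _ _ h => h, fun i hi => hΦ.flow_stepCond hi⟩
  rw [Option.eq_none_iff_forall_ne_some]
  intro v hv
  obtain ⟨p', hc, he⟩ := hΦ.flow_lo_eq_some.1 hv
  exact hΦ.edge_ne_of_consumed hc hc.1 le_rfl hp he.symm

/-! ### Phase-ordered derivations are super-streamlined -/

theorem WF.flow_downPath_lt (hΦ : Φ.WF) {v w : ℕ} {l : List ℕ}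
    (h : IsDownPath Φ.flow (.ver v) (.ver w) l) : v < w := by
  obtain ⟨hne, -, hstep, hsrc, htgt⟩ := h
  have key : ∀ i < l.length, ∀ u, Φ.flow.lo (l.getD i 0) = some u → v < u := by
    intro i
    induction i with
    | zero => exact fun _ u hu => hΦ.flow_up_lt_lo hsrc hu
    | succ i ih =>
      intro hi u hu
      obtain ⟨x, -, hx, hx'⟩ := hstep i hi
      exact (ih (by omega) x hx).trans (hΦ.flow_up_lt_lo hx' hu)
  exact key _ (Nat.sub_lt (List.length_pos_of_ne_nil hne) one_pos) w htgt

theorem label_eq {v : ℕ} {r : RuleName} (hv : v ∈ Φ.flow.V) (hr : r.isStructural = true) :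
    Φ.flow.η v = r.label ↔ (Φ.stepAt v).1 = r := by
  have hs := (mem_flow_V.1 hv).2
  change (Φ.stepAt v).1.label = r.label ↔ _
  generalize (Φ.stepAt v).1 = r' at hs
  cases r' <;> cases r <;> simp_all [RuleName.isStructural, RuleName.label]

theorem phaseOrder_stepAt (hord : Φ.steps.Pairwise fun t t' => PhaseOrder t.1 t'.1) {v w : ℕ}
    (hw : w < Φ.steps.length) (hvw : v < w) :
    PhaseOrder (Φ.stepAt v).1 (Φ.stepAt w).1 := by
  rw [stepAt, stepAt, List.getD_eq_getElem _ _ (hvw.trans hw), List.getD_eq_getElem _ _ hw]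
  exact List.pairwise_iff_getElem.1 hord v w _ hw hvw

/-- A vertex above another one does not carry a label that the phase order forbids. -/
theorem phaseOrder_of_label (hord : Φ.steps.Pairwise fun t t' => PhaseOrder t.1 t'.1) {v w : ℕ}
    (hv : v ∈ Φ.flow.V) (hw : w ∈ Φ.flow.V) (hvw : v < w) {r r' : RuleName}
    (hr : r.isStructural = true) (hr' : r'.isStructural = true) (h : Φ.flow.η v = r.label)
    (h' : Φ.flow.η w = r'.label) : PhaseOrder r r' := by
  rw [← (label_eq hv hr).1 h, ← (label_eq hw hr').1 h']
  exact phaseOrder_stepAt hord (mem_flow_V.1 hw).1 hvw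

theorem WF.noIWPath_flow (hΦ : Φ.WF)
    (hord : Φ.steps.Pairwise fun t t' => PhaseOrder t.1 t'.1) : NoIWPath Φ.flow := by
  rintro ⟨v, w, l, hv, hw, hηv, hηw, hpath⟩
  rcases hpath with hpath | ⟨hne, hE, -, hsrc, -⟩
  · have hvw := hΦ.flow_downPath_lt hpath
    rcases hηv with hηv | hηv <;> rcases hηw with hηw | hηw
    · have := phaseOrder_of_label (r := .aiDown) (r' := .aiUp) hord hv hw hvw rfl rfl hηv hηw
      simp [PhaseOrder] at this
    · have := phaseOrder_of_label (r := .aiDown) (r' := .awUp) hord hv hw hvw rfl rfl hηv hηw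
      simp [PhaseOrder] at this
    · have := phaseOrder_of_label (r := .awDown) (r' := .aiUp) hord hv hw hvw rfl rfl hηv hηw
      simp [PhaseOrder] at this
    · have := phaseOrder_of_label (r := .awDown) (r' := .awUp) hord hv hw hvw rfl rfl hηv hηw
      simp [PhaseOrder] at this
  · have hempty : Φ.flow.Ledges w = ∅ := by
      have := (hΦ.flow_degOK w hw).1
      rcases hηw with hηw | hηw <;> rw [hηw] at this <;> exact Finset.card_eq_zero.1 this
    have hmem : l.reverse.getD 0 0 ∈ Φ.flow.Ledges w :=
      Finset.mem_filter.2 ⟨hE _ (by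
        rw [List.getD_eq_getElem _ _ (List.length_pos_of_ne_nil hne)]
        exact List.getElem_mem _), hsrc⟩
    simp [hempty] at hmem

theorem WF.normalW_flow (hΦ : Φ.WF)
    (hord : Φ.steps.Pairwise fun t t' => PhaseOrder t.1 t'.1) : NormalW Φ.flow := by
  have key : ∀ {v w e : ℕ} (r r' : RuleName), v ∈ Φ.flow.V → w ∈ Φ.flow.V →
      r.isStructural = true → r'.isStructural = true → Φ.flow.η v = r.label →
      Φ.flow.η w = r'.label → Φ.flow.up e = some v → Φ.flow.lo e = some w → PhaseOrder r r' :=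
    fun _ _ hv hw hr hr' h h' hup hlo =>
      phaseOrder_of_label hord hv hw (hΦ.flow_up_lt_lo hup hlo) hr hr' h h'
  rintro ⟨B, h | h | h | h | h | h | h⟩
  · obtain ⟨v₁, v₂, e, _, _, h₁, h₂, -, l₁, l₂, -, -, -, -, -, -, hup, hlo, -⟩ := h
    simpa [PhaseOrder] using key .awDown .acDown h₁ h₂ rfl rfl l₁ l₂ hup hlo
  · obtain ⟨v₁, v₂, e, _, _, h₁, h₂, -, l₁, l₂, -, -, -, -, -, -, hlo, hup, -⟩ := h
    simpa [PhaseOrder] using key .acUp .awUp h₂ h₁ rfl rfl l₂ l₁ hup hlo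
  · obtain ⟨v₁, v₂, e, _, h₁, h₂, -, l₁, l₂, -, -, -, hup, hlo, -⟩ := h
    simpa [PhaseOrder] using key .awDown .aiUp h₁ h₂ rfl rfl l₁ l₂ hup hlo
  · obtain ⟨v₁, v₂, e, _, h₁, h₂, -, l₁, l₂, -, -, -, hlo, hup, -⟩ := h
    simpa [PhaseOrder] using key .aiDown .awUp h₂ h₁ rfl rfl l₂ l₁ hup hlo
  · obtain ⟨v₁, v₂, e, h₁, h₂, -, l₁, l₂, -, hup, hlo, -⟩ := h
    simpa [PhaseOrder] using key .awDown .awUp h₁ h₂ rfl rfl l₁ l₂ hup hlo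
  · obtain ⟨v₁, v₂, e, _, _, h₁, h₂, -, l₁, l₂, -, -, -, -, -, -, hup, hlo, -⟩ := h
    simpa [PhaseOrder] using key .awDown .acUp h₁ h₂ rfl rfl l₁ l₂ hup hlo
  · obtain ⟨v₁, v₂, e, _, _, h₁, h₂, -, l₁, l₂, -, -, -, -, -, -, hlo, hup, -⟩ := h
    simpa [PhaseOrder] using key .acDown .awUp h₂ h₁ rfl rfl l₂ l₁ hup hlo

theorem WF.superStreamlined (hΦ : Φ.WF)
    (hord : Φ.steps.Pairwise fun t t' => PhaseOrder t.1 t'.1) : SuperStreamlined Φ :=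
  ⟨Φ.flow, Φ.edge, id, hΦ.isAssocFlow, hΦ.noIWPath_flow hord, hΦ.normalW_flow hord⟩

end Deriv

end AF

namespace AF

/-- Every SKS derivation can be super-streamlined (and in
particular streamlined): for every SKS derivation `Φ` there is a
super-streamlined SKS derivation `Ψ` with the same premiss and the same
conclusion as `Φ`. -/
theorem statement_0 (Φ : Deriv) (hΦ : Φ.WF) :
    ∃ Ψ : Deriv, Ψ.WF ∧ Ψ.prem = Φ.prem ∧ Ψ.concl = Φ.concl ∧
      SuperStreamlined Ψ := by
  obtain ⟨Ψ, wf, hprem, hconcl, hord⟩ :=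
    (UpDown.of_entails fun v => hΦ.sound v).exists_phaseOrdered
  exact ⟨Ψ, wf, hprem, hconcl, wf.superStreamlined hord⟩

end AF
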